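/- Let {f_ε}_{0≤ε≤ε₀} be a good family and let s₀ be the scaling function of f₀ (the pointwise limit of the scaling functions s_ε as ε decreases to 0). Then s₀ has a jump discontinuity at every point a* of A: the limit of s₀(b*) as b* → a* with b* ≠ a* exists but is different from s₀(a*). -/

import Mathlib

open Set MeasureTheory Filter Topology

noncomputable def len (s : Set ℝ) : ℝ := (volume s).toReal

noncomputable def branch (f : ℝ → ℝ) : Bool → ℝ → ℝ
  | false => Function.invFunOn f (Icc (-1) 0)
  | true => Function.invFunOn f (Icc 0 1)

noncomputable def gw (f : ℝ → ℝ) : List Bool → ℝ → ℝ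
  | [] => id
  | b :: w => branch f b ∘ gw f w

noncomputable def Iw (f : ℝ → ℝ) (w : List Bool) : Set ℝ := gw f w '' Icc (-1) 1

def word (a : ℕ → Bool) (n : ℕ) : List Bool := ((List.range (n + 1)).reverse).map a

noncomputable def ratio (f : ℝ → ℝ) (a : ℕ → Bool) (n : ℕ) : ℝ :=
  len (Iw f (word a n)) / len (Iw f ((word a n).dropLast))

def IsScalingFun (f : ℝ → ℝ) (s : (ℕ → Bool) → ℝ) : Prop :=
  ∀ a : ℕ → Bool, Tendsto (ratio f a) atTop (nhds (s a))

def HolderOnDual (s : (ℕ → Bool) → ℝ) : Prop :=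
  ∃ C > (0:ℝ), ∃ lam ∈ Ioo (0:ℝ) 1, ∀ a b : ℕ → Bool, ∀ n : ℕ,
    (∀ k < n, a k = b k) → |s a - s b| ≤ C * lam ^ n

def EvZero (a : ℕ → Bool) : Prop := ∃ N, ∀ n ≥ N, a n = false

def Lambda (f : ℝ → ℝ) : Set ℝ := {x | ∀ n : ℕ, f^[n] x ∈ Icc (-1) 1}

structure GoodFamily where
  eps0 : ℝ
  eps0_pos : 0 < eps0
  f : ℝ → ℝ → ℝ
  f' : ℝ → ℝ → ℝ
  gamma : ℝ
  one_lt_gamma : 1 < gamma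
  mono : ∀ ε ∈ Icc 0 eps0, StrictMonoOn (f ε) (Icc (-1) 0)
  anti : ∀ ε ∈ Icc 0 eps0, StrictAntiOn (f ε) (Icc 0 1)
  map_neg_one : ∀ ε ∈ Icc 0 eps0, f ε (-1) = -1
  map_one : ∀ ε ∈ Icc 0 eps0, f ε 1 = -1
  map_zero : ∀ ε ∈ Icc 0 eps0, f ε 0 = 1 + ε
  smooth : ContDiffOn ℝ 1 (fun p : ℝ × ℝ => f p.1 p.2) (Icc 0 eps0 ×ˢ Icc (-1) 1)
  deriv_f : ∀ ε ∈ Icc 0 eps0, ∀ x ∈ Icc (-1:ℝ) 1,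
    HasDerivWithinAt (f ε) (f' ε x) (Icc (-1) 1) x
  Rneg : ℝ → ℝ → ℝ
  Rpos : ℝ → ℝ → ℝ
  Rneg_cont : ContinuousOn (fun p : ℝ × ℝ => Rneg p.1 p.2) (Icc 0 eps0 ×ˢ Icc (-1) 0)
  Rpos_cont : ContinuousOn (fun p : ℝ × ℝ => Rpos p.1 p.2) (Icc 0 eps0 ×ˢ Icc 0 1)
  Rneg_ne : ∀ ε ∈ Icc 0 eps0, ∀ x ∈ Icc (-1:ℝ) 0, Rneg ε x ≠ 0
  Rpos_ne : ∀ ε ∈ Icc 0 eps0, ∀ x ∈ Icc (0:ℝ) 1, Rpos ε x ≠ 0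
  Rneg_eq : ∀ ε ∈ Icc 0 eps0, ∀ x ∈ Ico (-1:ℝ) 0, Rneg ε x = f' ε x / |x| ^ (gamma - 1)
  Rpos_eq : ∀ ε ∈ Icc 0 eps0, ∀ x ∈ Ioc (0:ℝ) 1, Rpos ε x = f' ε x / |x| ^ (gamma - 1)
  K' : ℝ
  K'_pos : 0 < K'
  alpha' : ℝ
  alpha'_mem : alpha' ∈ Ioc (0:ℝ) 1
  holder' : ∀ ε ∈ Icc 0 eps0, ∀ x ∈ Icc (-1:ℝ) 1, ∀ y ∈ Icc (-1:ℝ) 1,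
    |f' ε x - f' ε y| ≤ K' * |x - y| ^ alpha'
  K'' : ℝ
  K''_pos : 0 < K''
  alpha'' : ℝ
  alpha''_mem : alpha'' ∈ Ioc (0:ℝ) 1
  holder''_neg : ∀ ε ∈ Icc 0 eps0, ∀ x ∈ Ico (-1:ℝ) 0, ∀ y ∈ Ico (-1:ℝ) 0,
    |f' ε x / |x| ^ (gamma - 1) - f' ε y / |y| ^ (gamma - 1)| ≤ K'' * |x - y| ^ alpha''
  holder''_pos : ∀ ε ∈ Icc 0 eps0, ∀ x ∈ Ioc (0:ℝ) 1, ∀ y ∈ Ioc (0:ℝ) 1,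
    |f' ε x / |x| ^ (gamma - 1) - f' ε y / |y| ^ (gamma - 1)| ≤ K'' * |x - y| ^ alpha''
  C0 : ℝ
  C0_pos : 0 < C0
  lam : ℝ
  lam_mem : lam ∈ Ioo (0:ℝ) 1
  decay : ∀ ε ∈ Icc 0 eps0, ∀ n : ℕ, 1 ≤ n → ∀ w : List Bool, w.length = n + 1 →
    len (Iw (f ε) w) ≤ C0 * lam ^ n

/-- The closed half-interval on which `branch f b` takes its values. -/
def side : Bool → Set ℝ
  | false => Icc (-1) 0
  | true => Icc 0 1

/-- The sign of the points of `side b`. -/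
def sgn : Bool → ℝ
  | false => -1
  | true => 1

lemma abs_sgn (b : Bool) : |sgn b| = 1 := by cases b <;> norm_num [sgn]

lemma side_subset (b : Bool) : side b ⊆ Icc (-1) 1 := by
  cases b
  · exact Icc_subset_Icc_right zero_le_one
  · exact Icc_subset_Icc_left (by norm_num)

lemma sgn_mul_abs {b : Bool} {x : ℝ} (hx : x ∈ side b) : sgn b * |x| = x := by
  cases b
  · simp only [sgn]; rw [abs_of_nonpos hx.2]; ring
  · simp only [sgn]; rw [abs_of_nonneg hx.1]; ring

lemma sgn_mul_mem_side {b : Bool} {t : ℝ} (ht : t ∈ Icc (0 : ℝ) 1) : sgn b * t ∈ side b := by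
  cases b <;> simp only [sgn, side, mem_Icc] at ht ⊢ <;> constructor <;> linarith [ht.1, ht.2]

lemma abs_sgn_mul {b : Bool} {t : ℝ} (ht : 0 ≤ t) : |sgn b * t| = t := by
  rw [abs_mul, abs_sgn, one_mul, abs_of_nonneg ht]

lemma abs_mem_of_mem_side {b : Bool} {x : ℝ} (hx : x ∈ side b) : |x| ∈ Icc (0 : ℝ) 1 :=
  ⟨abs_nonneg x, abs_le.2 (side_subset b hx)⟩

lemma abs_sub_abs_of_mem_side {b : Bool} {x y : ℝ} (hx : x ∈ side b) (hy : y ∈ side b) :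
    |(|x| - |y|)| = |x - y| := by
  conv_rhs => rw [← sgn_mul_abs hx, ← sgn_mul_abs hy, ← mul_sub, abs_mul, abs_sgn, one_mul]

lemma uIcc_subset_side {b : Bool} {x y : ℝ} (hx : x ∈ side b) (hy : y ∈ side b) :
    uIcc x y ⊆ side b := by
  cases b <;> exact uIcc_subset_Icc hx hy

/-- The topological properties of a map of a good family. -/
structure IsUnimodal (ε : ℝ) (f : ℝ → ℝ) : Prop where
  eps_nonneg : 0 ≤ ε
  mono : StrictMonoOn f (Icc (-1) 0)
  anti : StrictAntiOn f (Icc 0 1)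
  map_neg_one : f (-1) = -1
  map_one : f 1 = -1
  map_zero : f 0 = 1 + ε
  cont : ContinuousOn f (Icc (-1) 1)

lemma branch_eq_invFunOn (f : ℝ → ℝ) (b : Bool) : branch f b = Function.invFunOn f (side b) := by
  cases b <;> rfl

lemma gw_append (f : ℝ → ℝ) (u v : List Bool) (x : ℝ) : gw f (u ++ v) x = gw f u (gw f v x) := by
  induction u with
  | nil => rfl
  | cons b u ih => simp only [List.cons_append, gw, Function.comp_apply, ih]

lemma gw_cons (f : ℝ → ℝ) (b : Bool) (w : List Bool) (x : ℝ) :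
    gw f (b :: w) x = branch f b (gw f w x) := rfl

lemma neg_one_mem : (-1 : ℝ) ∈ Icc (-1 : ℝ) 1 := by norm_num

lemma one_mem : (1 : ℝ) ∈ Icc (-1 : ℝ) 1 := by norm_num

namespace IsUnimodal

variable {ε : ℝ} {f : ℝ → ℝ}

lemma strictAntiOn_sgn_mul (hf : IsUnimodal ε f) (b : Bool) :
    StrictAntiOn (fun t => f (sgn b * t)) (Icc 0 1) := by
  intro s hs t ht hst
  have hs' := sgn_mul_mem_side (b := b) hs
  have ht' := sgn_mul_mem_side (b := b) ht
  cases b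
  · exact hf.mono ht' hs' (by simp only [sgn]; linarith)
  · exact hf.anti hs' ht' (by simp only [sgn]; linarith)

lemma map_lt_map_iff (hf : IsUnimodal ε f) {b : Bool} {x y : ℝ} (hx : x ∈ side b)
    (hy : y ∈ side b) : f x < f y ↔ |y| < |x| := by
  have h := (hf.strictAntiOn_sgn_mul b).lt_iff_gt (abs_mem_of_mem_side hx)
    (abs_mem_of_mem_side hy)
  simpa only [sgn_mul_abs hx, sgn_mul_abs hy] using h

lemma map_le_map_iff (hf : IsUnimodal ε f) {b : Bool} {x y : ℝ} (hx : x ∈ side b)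
    (hy : y ∈ side b) : f x ≤ f y ↔ |y| ≤ |x| := by
  simpa only [not_lt] using (hf.map_lt_map_iff hy hx).not

lemma injOn (hf : IsUnimodal ε f) (b : Bool) : InjOn f (side b) := by
  cases b
  · exact hf.mono.injOn
  · exact hf.anti.injOn

lemma surjOn (hf : IsUnimodal ε f) (b : Bool) : SurjOn f (side b) (Icc (-1) 1) := by
  have he := hf.eps_nonneg
  cases b
  · have h := intermediate_value_Icc (show (-1 : ℝ) ≤ 0 by norm_num)
      (hf.cont.mono (side_subset false))
    rw [hf.map_neg_one, hf.map_zero] at h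
    exact (Icc_subset_Icc_right (by linarith)).trans h
  · have h := intermediate_value_Icc' (zero_le_one' ℝ) (hf.cont.mono (side_subset true))
    rw [hf.map_one, hf.map_zero] at h
    exact (Icc_subset_Icc_right (by linarith)).trans h

lemma branch_mem (hf : IsUnimodal ε f) (b : Bool) {y : ℝ} (hy : y ∈ Icc (-1 : ℝ) 1) :
    branch f b y ∈ side b := by
  rw [branch_eq_invFunOn]
  exact Function.invFunOn_mem (hf.surjOn b hy)

lemma branch_mem_Icc (hf : IsUnimodal ε f) (b : Bool) {y : ℝ} (hy : y ∈ Icc (-1 : ℝ) 1) :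
    branch f b y ∈ Icc (-1 : ℝ) 1 :=
  side_subset b (hf.branch_mem b hy)

lemma map_branch (hf : IsUnimodal ε f) (b : Bool) {y : ℝ} (hy : y ∈ Icc (-1 : ℝ) 1) :
    f (branch f b y) = y := by
  rw [branch_eq_invFunOn]
  exact Function.invFunOn_eq (hf.surjOn b hy)

lemma branch_map (hf : IsUnimodal ε f) {b : Bool} {x : ℝ} (hx : x ∈ side b)
    (hfx : f x ∈ Icc (-1 : ℝ) 1) : branch f b (f x) = x :=
  hf.injOn b (hf.branch_mem b hfx) hx (hf.map_branch b hfx)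

lemma branch_false_neg_one (hf : IsUnimodal ε f) : branch f false (-1) = -1 := by
  have h := hf.branch_map (b := false) (x := -1) (by norm_num [side])
    (by rw [hf.map_neg_one]; exact neg_one_mem)
  rwa [hf.map_neg_one] at h

lemma branch_true_neg_one (hf : IsUnimodal ε f) : branch f true (-1) = 1 := by
  have h := hf.branch_map (b := true) (x := 1) (by norm_num [side])
    (by rw [hf.map_one]; exact neg_one_mem)
  rwa [hf.map_one] at h

lemma abs_branch_lt_iff (hf : IsUnimodal ε f) (b : Bool) {x y : ℝ} (hx : x ∈ Icc (-1 : ℝ) 1)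
    (hy : y ∈ Icc (-1 : ℝ) 1) : |branch f b x| < |branch f b y| ↔ y < x := by
  rw [← hf.map_lt_map_iff (hf.branch_mem b hy) (hf.branch_mem b hx), hf.map_branch b hx,
    hf.map_branch b hy]

lemma strictMonoOn_branch_false (hf : IsUnimodal ε f) :
    StrictMonoOn (branch f false) (Icc (-1) 1) := by
  intro x hx y hy hxy
  have h := (hf.abs_branch_lt_iff false hy hx).2 hxy
  have h1 := hf.branch_mem false hx
  have h2 := hf.branch_mem false hy
  rw [abs_of_nonpos h1.2, abs_of_nonpos h2.2] at h
  linarith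

lemma strictAntiOn_branch_true (hf : IsUnimodal ε f) :
    StrictAntiOn (branch f true) (Icc (-1) 1) := by
  intro x hx y hy hxy
  have h := (hf.abs_branch_lt_iff true hy hx).2 hxy
  have h1 := hf.branch_mem true hx
  have h2 := hf.branch_mem true hy
  rwa [abs_of_nonneg h1.1, abs_of_nonneg h2.1] at h

lemma branch_injOn (hf : IsUnimodal ε f) (b : Bool) : InjOn (branch f b) (Icc (-1) 1) := by
  cases b
  · exact hf.strictMonoOn_branch_false.injOn
  · exact hf.strictAntiOn_branch_true.injOn

lemma image_branch_uIcc (hf : IsUnimodal ε f) (b : Bool) {p q : ℝ} (hp : p ∈ Icc (-1 : ℝ) 1)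
    (hq : q ∈ Icc (-1 : ℝ) 1) :
    branch f b '' uIcc p q = uIcc (branch f b p) (branch f b q) := by
  have hpq : uIcc p q ⊆ Icc (-1 : ℝ) 1 := uIcc_subset_Icc hp hq
  have hs := uIcc_subset_side (hf.branch_mem b hp) (hf.branch_mem b hq)
  apply Subset.antisymm
  · rw [image_subset_iff]
    cases b
    · exact (hf.strictMonoOn_branch_false.monotoneOn.mono hpq).mapsTo_uIcc
    · exact (hf.strictAntiOn_branch_true.antitoneOn.mono hpq).mapsTo_uIcc
  · intro z hz
    have hfz : f z ∈ uIcc p q := by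
      have hm : MapsTo f (uIcc (branch f b p) (branch f b q))
          (uIcc (f (branch f b p)) (f (branch f b q))) := by
        cases b
        · exact (hf.mono.monotoneOn.mono hs).mapsTo_uIcc
        · exact (hf.anti.antitoneOn.mono hs).mapsTo_uIcc
      have := hm hz
      rwa [hf.map_branch b hp, hf.map_branch b hq] at this
    exact ⟨f z, hfz, hf.branch_map (hs hz) (hpq hfz)⟩

lemma gw_mem (hf : IsUnimodal ε f) (w : List Bool) {x : ℝ} (hx : x ∈ Icc (-1 : ℝ) 1) :
    gw f w x ∈ Icc (-1 : ℝ) 1 := by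
  induction w with
  | nil => exact hx
  | cons b w ih => exact hf.branch_mem_Icc b ih

lemma gw_injOn (hf : IsUnimodal ε f) (w : List Bool) : InjOn (gw f w) (Icc (-1) 1) := by
  induction w with
  | nil => exact fun _ _ _ _ h => h
  | cons b w ih =>
    exact fun x hx y hy h => ih hx hy (hf.branch_injOn b (hf.gw_mem w hx) (hf.gw_mem w hy) h)

lemma image_gw_uIcc (hf : IsUnimodal ε f) (w : List Bool) {p q : ℝ} (hp : p ∈ Icc (-1 : ℝ) 1)
    (hq : q ∈ Icc (-1 : ℝ) 1) : gw f w '' uIcc p q = uIcc (gw f w p) (gw f w q) := by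
  induction w with
  | nil => exact image_id _
  | cons b w ih =>
    rw [gw, image_comp, ih, hf.image_branch_uIcc b (hf.gw_mem w hp) (hf.gw_mem w hq)]
    rfl

lemma Iw_eq (hf : IsUnimodal ε f) (w : List Bool) :
    Iw f w = uIcc (gw f w (-1)) (gw f w 1) := by
  rw [Iw, ← hf.image_gw_uIcc w neg_one_mem one_mem, uIcc_of_le (by norm_num)]

lemma len_Iw (hf : IsUnimodal ε f) (w : List Bool) :
    len (Iw f w) = |gw f w 1 - gw f w (-1)| := by
  rw [hf.Iw_eq, len, uIcc, Real.volume_Icc, max_sub_min_eq_abs,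
    ENNReal.toReal_ofReal (abs_nonneg _)]

lemma Iw_subset (hf : IsUnimodal ε f) (w : List Bool) : Iw f w ⊆ Icc (-1) 1 := by
  rintro _ ⟨x, hx, rfl⟩
  exact hf.gw_mem w hx

lemma Iw_cons (f : ℝ → ℝ) (b : Bool) (w : List Bool) : Iw f (b :: w) = branch f b '' Iw f w := by
  rw [Iw, Iw, gw, image_comp]

lemma abs_sub_le_len (hf : IsUnimodal ε f) {w : List Bool} {x y : ℝ} (hx : x ∈ Iw f w)
    (hy : y ∈ Iw f w) : |x - y| ≤ len (Iw f w) := by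
  rw [hf.len_Iw, abs_sub_comm]
  rw [hf.Iw_eq] at hx hy
  rw [abs_sub_comm (gw f w 1)]
  exact abs_sub_le_of_uIcc_subset_uIcc (uIcc_subset_uIcc hx hy) |>.trans_eq (abs_sub_comm _ _)

lemma len_pos (hf : IsUnimodal ε f) (w : List Bool) : 0 < len (Iw f w) := by
  rw [hf.len_Iw, abs_pos, sub_ne_zero]
  exact fun h => by have := hf.gw_injOn w one_mem neg_one_mem h; norm_num at this

/-- Only words without the letter `1` have `-1` in the interval they determine. -/
lemma neg_one_lt_gw (hf : IsUnimodal ε f) {w : List Bool} (hw : true ∈ w) {x : ℝ}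
    (hx : x ∈ Icc (-1 : ℝ) 1) : -1 < gw f w x := by
  induction w with
  | nil => simp at hw
  | cons b w ih =>
    cases b
    · have hlt := ih (by simpa using hw)
      have := hf.strictMonoOn_branch_false neg_one_mem (hf.gw_mem w hx) hlt
      rwa [hf.branch_false_neg_one] at this
    · have := (hf.branch_mem true (hf.gw_mem w hx)).1
      rw [gw_cons]
      linarith

end IsUnimodal

/-- Constants governing the distortion of the maps of a good family. -/
structure DistortionConstants where
  γ : ℝ
  m : ℝ
  M : ℝ
  H : ℝ
  α : ℝ
  C : ℝ
  lam : ℝ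
  one_lt_γ : 1 < γ
  m_pos : 0 < m
  M_pos : 0 < M
  H_nonneg : 0 ≤ H
  α_mem : α ∈ Ioc (0 : ℝ) 1
  C_pos : 0 < C
  lam_mem : lam ∈ Ioo (0 : ℝ) 1

namespace DistortionConstants

variable (k : DistortionConstants)

lemma γ_pos : 0 < k.γ := one_pos.trans k.one_lt_γ

/-- The factor by which relative lengths at the critical value control the distortion caused by
the critical point. -/
noncomputable def critFactor : ℝ := (k.γ - 1) * (k.M / (k.m * k.γ))

lemma critFactor_nonneg : 0 ≤ k.critFactor := by
  have := k.γ_pos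
  have := k.m_pos
  have := k.M_pos
  have := k.one_lt_γ
  exact mul_nonneg (by linarith) (by positivity)

end DistortionConstants

/-- A unimodal map with derivative `f'` whose geometry is controlled by the constants `k`. -/
structure IsControlled (k : DistortionConstants) (ε : ℝ) (f f' : ℝ → ℝ) : Prop
    extends IsUnimodal ε f where
  deriv : ∀ x ∈ Icc (-1 : ℝ) 1, HasDerivWithinAt f (f' x) (Icc (-1) 1) x
  lower : ∀ b, ∀ t ∈ Ioc (0 : ℝ) 1, k.m * t ^ (k.γ - 1) ≤ -(f' (sgn b * t) * sgn b)
  upper : ∀ b, ∀ t ∈ Ioc (0 : ℝ) 1, -(f' (sgn b * t) * sgn b) ≤ k.M * t ^ (k.γ - 1)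
  log_holder : ∀ b, ∀ x ∈ side b, ∀ y ∈ side b, x ≠ 0 → y ≠ 0 →
    |Real.log (f' x) - Real.log (f' y)| ≤
      k.H * |x - y| ^ k.α + (k.γ - 1) * |Real.log x - Real.log y|
  decay : ∀ w, len (Iw f w) ≤ k.C * k.lam ^ w.length

namespace IsControlled

variable {k : DistortionConstants} {ε : ℝ} {f f' : ℝ → ℝ}

lemma deriv_at (hf : IsControlled k ε f f') {x : ℝ} (hx : x ∈ Ioo (-1 : ℝ) 1) :
    HasDerivAt f (f' x) x :=
  (hf.deriv x (Ioo_subset_Icc_self hx)).hasDerivAt (Icc_mem_nhds hx.1 hx.2)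

lemma deriv_sgn_mul (hf : IsControlled k ε f f') (b : Bool) {t : ℝ} (ht : t ∈ Ioo (0 : ℝ) 1) :
    HasDerivAt (fun t => f (sgn b * t)) (f' (sgn b * t) * sgn b) t := by
  have hmem : sgn b * t ∈ Ioo (-1 : ℝ) 1 := by
    rw [mem_Ioo, ← abs_lt, abs_sgn_mul ht.1.le]
    exact ht.2
  have h := (hf.deriv_at hmem).comp t ((hasDerivAt_id t).const_mul (sgn b))
  simpa only [Function.comp_def, id, mul_one] using h

lemma abs_deriv_pos (hf : IsControlled k ε f f') {b : Bool} {x : ℝ} (hx : x ∈ side b)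
    (hx0 : x ≠ 0) : 0 < |f' x| := by
  have ht : 0 < |x| := abs_pos.2 hx0
  have h := hf.lower b |x| ⟨ht, (abs_mem_of_mem_side hx).2⟩
  rw [sgn_mul_abs hx] at h
  have h2 : 0 < k.m * |x| ^ (k.γ - 1) := mul_pos k.m_pos (Real.rpow_pos_of_pos ht _)
  refine abs_pos.2 fun h0 => ?_
  rw [h0] at h
  linarith

lemma continuousOn_sgn_mul (hf : IsControlled k ε f f') (b : Bool) :
    ContinuousOn (fun t => f (sgn b * t)) (Icc 0 1) :=
  hf.cont.comp (by fun_prop) fun _ ht => side_subset b (sgn_mul_mem_side ht)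

lemma hasDerivAt_add_rpow (hf : IsControlled k ε f f') (b : Bool) (c : ℝ) {t : ℝ}
    (ht : t ∈ Ioo (0 : ℝ) 1) :
    HasDerivAt (fun t => f (sgn b * t) + c / k.γ * t ^ k.γ)
      (f' (sgn b * t) * sgn b + c * t ^ (k.γ - 1)) t := by
  have h := (hf.deriv_sgn_mul b ht).add
    ((Real.hasDerivAt_rpow_const (p := k.γ) (Or.inl ht.1.ne')).const_mul (c / k.γ))
  have hγ := k.γ_pos.ne'
  rwa [← mul_assoc (c / k.γ), div_mul_cancel₀ _ hγ] at h

lemma continuousOn_add_rpow (hf : IsControlled k ε f f') (b : Bool) (c : ℝ) :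
    ContinuousOn (fun t => f (sgn b * t) + c / k.γ * t ^ k.γ) (Icc 0 1) :=
  (hf.continuousOn_sgn_mul b).add (continuousOn_const.mul
    (continuousOn_id.rpow_const fun _ _ => Or.inr k.γ_pos.le))

lemma lower_rpow (hf : IsControlled k ε f f') {b : Bool} {x y : ℝ} (hx : x ∈ side b)
    (hy : y ∈ side b) (hxy : |x| ≤ |y|) :
    k.m / k.γ * (|y| ^ k.γ - |x| ^ k.γ) ≤ f x - f y := by
  have h : AntitoneOn (fun t => f (sgn b * t) + k.m / k.γ * t ^ k.γ) (Icc 0 1) := by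
    refine antitoneOn_of_hasDerivWithinAt_nonpos (convex_Icc 0 1) (hf.continuousOn_add_rpow b _)
      (f' := fun t => f' (sgn b * t) * sgn b + k.m * t ^ (k.γ - 1)) ?_ ?_ <;>
    rw [interior_Icc] <;> intro t ht
    · exact (hf.hasDerivAt_add_rpow b _ ht).hasDerivWithinAt
    · have := hf.lower b t ⟨ht.1, ht.2.le⟩
      linarith
  have := h (abs_mem_of_mem_side hx) (abs_mem_of_mem_side hy) hxy
  simp only [sgn_mul_abs hx, sgn_mul_abs hy] at this
  linarith

lemma upper_rpow (hf : IsControlled k ε f f') {b : Bool} {x y : ℝ} (hx : x ∈ side b)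
    (hy : y ∈ side b) (hxy : |x| ≤ |y|) :
    f x - f y ≤ k.M / k.γ * (|y| ^ k.γ - |x| ^ k.γ) := by
  have h : MonotoneOn (fun t => f (sgn b * t) + k.M / k.γ * t ^ k.γ) (Icc 0 1) := by
    refine monotoneOn_of_hasDerivWithinAt_nonneg (convex_Icc 0 1) (hf.continuousOn_add_rpow b _)
      (f' := fun t => f' (sgn b * t) * sgn b + k.M * t ^ (k.γ - 1)) ?_ ?_ <;>
    rw [interior_Icc] <;> intro t ht
    · exact (hf.hasDerivAt_add_rpow b _ ht).hasDerivWithinAt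
    · have := hf.upper b t ⟨ht.1, ht.2.le⟩
      linarith
  have := h (abs_mem_of_mem_side hx) (abs_mem_of_mem_side hy) hxy
  simp only [sgn_mul_abs hx, sgn_mul_abs hy] at this
  linarith

lemma zero_mem_side (b : Bool) : (0 : ℝ) ∈ side b := by cases b <;> norm_num [side]

lemma log_abs_sub_le (hf : IsControlled k ε f f') {b : Bool} {x y E : ℝ} (hx : x ∈ side b)
    (hy : y ∈ side b) (hx0 : x ≠ 0) (hy0 : y ≠ 0) (hE : 0 ≤ E)
    (h : |f x - f y| ≤ E * (1 - max (f x) (f y))) :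
    |Real.log x - Real.log y| ≤ k.M / (k.m * k.γ) * E := by
  wlog hxy : |x| ≤ |y| generalizing x y
  · rw [abs_sub_comm]
    exact this hy hx hy0 hx0 (by rwa [abs_sub_comm, max_comm]) (le_of_not_ge hxy)
  have hγ := k.γ_pos
  have hm := k.m_pos
  have hx1 : 0 < |x| := abs_pos.2 hx0
  have hy1 : 0 < |y| := abs_pos.2 hy0
  have hfyx : f y ≤ f x := (hf.map_le_map_iff hy hx).2 hxy
  rw [abs_of_nonneg (sub_nonneg.2 hfyx), max_eq_left hfyx] at h
  rw [← Real.log_abs x, ← Real.log_abs y]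
  have h1 := hf.lower_rpow hx hy hxy
  have h2 := hf.upper_rpow (zero_mem_side b) hx (by simp)
  rw [hf.map_zero, abs_zero, Real.zero_rpow hγ.ne', sub_zero] at h2
  have hA : 0 < |x| ^ k.γ := Real.rpow_pos_of_pos hx1 _
  have hB : 0 < |y| ^ k.γ := Real.rpow_pos_of_pos hy1 _
  have hlog : k.γ * (Real.log |y| - Real.log |x|) ≤ |y| ^ k.γ / |x| ^ k.γ - 1 := by
    have := Real.log_le_sub_one_of_pos (div_pos hB hA)
    rwa [Real.log_div hB.ne' hA.ne', Real.log_rpow hx1, Real.log_rpow hy1, ← mul_sub] at this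
  have hdiff : k.m / k.γ * (|y| ^ k.γ - |x| ^ k.γ) ≤ E * (k.M / k.γ * |x| ^ k.γ) := by
    refine h1.trans (h.trans (mul_le_mul_of_nonneg_left ?_ hE))
    linarith [hf.eps_nonneg]
  have hquot : |y| ^ k.γ / |x| ^ k.γ - 1 ≤ k.M / k.m * E := by
    rw [div_sub_one hA.ne', div_le_iff₀ hA]
    have : k.m / k.γ * (|y| ^ k.γ - |x| ^ k.γ) ≤ k.m / k.γ * (k.M / k.m * E * |x| ^ k.γ) := by
      refine hdiff.trans_eq ?_
      field_simp
    exact le_of_mul_le_mul_left this (by positivity)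
  have hle : Real.log |x| ≤ Real.log |y| := Real.log_le_log hx1 hxy
  rw [abs_sub_comm, abs_of_nonneg (sub_nonneg.2 hle)]
  have : k.γ * (Real.log |y| - Real.log |x|) ≤ k.γ * (k.M / (k.m * k.γ) * E) := by
    refine hlog.trans (hquot.trans_eq ?_)
    field_simp
  exact le_of_mul_le_mul_left this hγ

/-- Distortion of the derivative between two points, in terms of the relative distance of their
images to the critical value. -/
lemma log_deriv_sub_le (hf : IsControlled k ε f f') (b : Bool) {y y' E : ℝ}
    (hy : y ∈ Icc (-1 : ℝ) 1) (hy' : y' ∈ Icc (-1 : ℝ) 1) (h0 : branch f b y ≠ 0)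
    (h0' : branch f b y' ≠ 0) (hE : 0 ≤ E) (h : |y - y'| ≤ E * (1 - max y y')) :
    |Real.log (f' (branch f b y)) - Real.log (f' (branch f b y'))| ≤
      k.H * |branch f b y - branch f b y'| ^ k.α + k.critFactor * E := by
  have hm := hf.branch_mem b hy
  have hm' := hf.branch_mem b hy'
  refine (hf.log_holder b _ hm _ hm' h0 h0').trans ?_
  have h2 := hf.log_abs_sub_le hm hm' h0 h0' hE
    (by rwa [hf.map_branch b hy, hf.map_branch b hy'])
  have h3 : 0 ≤ k.γ - 1 := by linarith [k.one_lt_γ]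
  have := mul_le_mul_of_nonneg_left h2 h3
  rw [DistortionConstants.critFactor]
  linarith

lemma log_deriv_sub_le_of_nonpos (hf : IsControlled k ε f f') (b : Bool) {y y' : ℝ}
    (hy : y ∈ Icc (-1 : ℝ) 0) (hy' : y' ∈ Icc (-1 : ℝ) 0) :
    |Real.log (f' (branch f b y)) - Real.log (f' (branch f b y'))| ≤
      k.H * |branch f b y - branch f b y'| ^ k.α + k.critFactor * |y - y'| := by
  have hs : Icc (-1 : ℝ) 0 ⊆ Icc (-1) 1 := side_subset false
  have hne : ∀ z ∈ Icc (-1 : ℝ) 0, branch f b z ≠ 0 := by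
    intro z hz h0
    have := hf.map_branch b (hs hz)
    rw [h0, hf.map_zero] at this
    linarith [hz.2, hf.eps_nonneg]
  refine hf.log_deriv_sub_le b (hs hy) (hs hy') (hne y hy) (hne y' hy') (abs_nonneg _) ?_
  refine le_mul_of_one_le_right (abs_nonneg _) ?_
  linarith [max_le hy.2 hy'.2]

lemma exists_abs_sub_eq (hf : IsControlled k ε f f') (b : Bool) {p q : ℝ}
    (hp : p ∈ Icc (-1 : ℝ) 1) (hq : q ∈ Icc (-1 : ℝ) 1) (hpq : p ≠ q) :
    ∃ z ∈ uIcc p q, branch f b z ≠ 0 ∧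
      |p - q| = |f' (branch f b z)| * |branch f b p - branch f b q| := by
  wlog hlt : branch f b p < branch f b q generalizing p q
  · obtain ⟨z, hz, h1, h2⟩ := this hq hp hpq.symm (lt_of_le_of_ne (not_lt.1 hlt)
      fun h => hpq (hf.branch_injOn b hp hq h.symm))
    exact ⟨z, by rwa [uIcc_comm], h1, by rwa [abs_sub_comm p, abs_sub_comm (branch f b p)]⟩
  have hsub : Icc (branch f b p) (branch f b q) ⊆ side b := by
    rw [← uIcc_of_le hlt.le]
    exact uIcc_subset_side (hf.branch_mem b hp) (hf.branch_mem b hq)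
  have hsub1 := hsub.trans (side_subset b)
  obtain ⟨c, hc, hceq⟩ := exists_hasDerivAt_eq_slope f f' hlt (hf.cont.mono hsub1)
    fun x hx => hf.deriv_at ⟨(hsub1 (left_mem_Icc.2 hlt.le)).1.trans_lt hx.1,
      hx.2.trans_le (hsub1 (right_mem_Icc.2 hlt.le)).2⟩
  have hc' : c ∈ uIcc (branch f b p) (branch f b q) := by
    rw [uIcc_of_le hlt.le]
    exact Ioo_subset_Icc_self hc
  rw [← hf.image_branch_uIcc b hp hq] at hc'
  obtain ⟨z, hz, rfl⟩ := hc'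
  refine ⟨z, hz, fun h0 => ?_, ?_⟩
  · have h1 := hf.branch_mem b hp
    have h2 := hf.branch_mem b hq
    rw [h0] at hc
    cases b
    · exact (hc.2.trans_le h2.2).false
    · exact (hc.1.trans_le' h1.1).false
  · rw [hceq, hf.map_branch b hp, hf.map_branch b hq, abs_div, abs_sub_comm q,
      abs_sub_comm (branch f b q), div_mul_cancel₀]
    exact (abs_pos.2 (sub_ne_zero.2 hlt.ne)).ne'

end IsControlled

/-- The number of leading zeros of a word. -/
def leadingZeros : List Bool → ℕ
  | [] => 0
  | true :: _ => 0
  | false :: w => leadingZeros w + 1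

/-- The length of `I_w` relative to its distance to the fixed point `-1`. -/
noncomputable def relLen (f : ℝ → ℝ) (w : List Bool) : ℝ :=
  len (Iw f w) / (1 + min (gw f w (-1)) (gw f w 1))

namespace DistortionConstants

variable (k : DistortionConstants)

/-- The rate at which distortion decays. -/
noncomputable def θ : ℝ := k.lam ^ k.α

lemma θ_pos : 0 < k.θ := Real.rpow_pos_of_pos k.lam_mem.1 _

lemma θ_lt_one : k.θ < 1 := Real.rpow_lt_one k.lam_mem.1.le k.lam_mem.2 k.α_mem.1

lemma lam_le_θ : k.lam ≤ k.θ := by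
  have := Real.rpow_le_rpow_of_exponent_ge k.lam_mem.1 k.lam_mem.2.le k.α_mem.2
  rwa [Real.rpow_one] at this

lemma lam_pow_le (n : ℕ) : k.lam ^ n ≤ k.θ ^ n :=
  pow_le_pow_left₀ k.lam_mem.1.le k.lam_le_θ n

lemma θ_pow_le {i j : ℕ} (h : i ≤ j) : k.θ ^ j ≤ k.θ ^ i :=
  pow_le_pow_of_le_one k.θ_pos.le k.θ_lt_one.le h

lemma rpow_le_of_le_decay {x : ℝ} {n : ℕ} (hx : 0 ≤ x) (h : x ≤ k.C * k.lam ^ n) :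
    x ^ k.α ≤ k.C ^ k.α * k.θ ^ n := by
  refine (Real.rpow_le_rpow hx h k.α_mem.1.le).trans_eq ?_
  rw [Real.mul_rpow k.C_pos.le (pow_nonneg k.lam_mem.1.le _), θ, ← Real.rpow_natCast k.lam,
    ← Real.rpow_mul k.lam_mem.1.le, mul_comm (n : ℝ), Real.rpow_mul k.lam_mem.1.le,
    Real.rpow_natCast]

/-- Distortion constant for the iterates of the left branch near the fixed point. -/
noncomputable def fixConst : ℝ := k.H * k.C ^ k.α + k.critFactor * k.C

lemma fixConst_nonneg : 0 ≤ k.fixConst :=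
  add_nonneg (mul_nonneg k.H_nonneg (Real.rpow_nonneg k.C_pos.le _))
    (mul_nonneg k.critFactor_nonneg k.C_pos.le)

/-- Total distortion constant for the iterates of the left branch. -/
noncomputable def runConst : ℝ := k.fixConst / (1 - k.θ)

lemma runConst_nonneg : 0 ≤ k.runConst :=
  div_nonneg k.fixConst_nonneg (sub_nonneg.2 k.θ_lt_one.le)

/-- The factor comparing lengths and potentials. -/
noncomputable def potConst : ℝ := (1 + k.M) * Real.exp k.runConst

lemma potConst_nonneg : 0 ≤ k.potConst :=
  mul_nonneg (by linarith [k.M_pos]) (Real.exp_pos _).le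

/-- The factor comparing relative lengths at `-1` and at the critical value. -/
noncomputable def foldConst : ℝ := k.M * k.γ / (k.m * (1 / 2) ^ (k.γ - 1))

lemma foldConst_nonneg : 0 ≤ k.foldConst := by
  have := k.M_pos
  have := k.m_pos
  have := k.γ_pos
  rw [foldConst]
  positivity

/-- The constant for the distortion of a single step. -/
noncomputable def stepConst : ℝ := k.H * k.C ^ k.α + k.critFactor * (2 * k.C + k.foldConst)

lemma stepConst_nonneg : 0 ≤ k.stepConst :=
  add_nonneg (mul_nonneg k.H_nonneg (Real.rpow_nonneg k.C_pos.le _))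
    (mul_nonneg k.critFactor_nonneg (by linarith [k.C_pos, k.foldConst_nonneg]))

end DistortionConstants

/-- Relative length weighted so that it does not increase along runs of zeros. -/
noncomputable def potential (k : DistortionConstants) (f : ℝ → ℝ) (w : List Bool) : ℝ :=
  relLen f w * Real.exp (k.runConst * k.θ ^ leadingZeros w)

namespace IsControlled

variable {k : DistortionConstants} {ε : ℝ} {f f' : ℝ → ℝ}

lemma len_le (hf : IsControlled k ε f f') (w : List Bool) {n : ℕ} (hn : n ≤ w.length) :
    len (Iw f w) ≤ k.C * k.θ ^ n :=
  (hf.decay w).trans (mul_le_mul_of_nonneg_left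
    ((k.lam_pow_le _).trans (k.θ_pow_le hn)) k.C_pos.le)

lemma gw_mem_Iw (f : ℝ → ℝ) (w : List Bool) {x : ℝ} (hx : x ∈ Icc (-1 : ℝ) 1) :
    gw f w x ∈ Iw f w := mem_image_of_mem _ hx

lemma exists_gw_eq_replicate (hf : IsControlled k ε f f') (w : List Bool) {x : ℝ}
    (hx : x ∈ Icc (-1 : ℝ) 1) :
    ∃ y ∈ Icc (-1 : ℝ) 1, gw f w x = gw f (List.replicate (leadingZeros w) false) y := by
  induction w with
  | nil => exact ⟨x, hx, rfl⟩
  | cons b w ih =>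
    cases b
    · obtain ⟨y, hy, h⟩ := ih
      exact ⟨y, hy, by rw [gw_cons, h]; rfl⟩
    · exact ⟨_, hf.gw_mem (true :: w) hx, rfl⟩

lemma gw_replicate_neg_one (hf : IsControlled k ε f f') (n : ℕ) :
    gw f (List.replicate n false) (-1) = -1 := by
  induction n with
  | zero => rfl
  | succ n ih => rw [List.replicate_succ, gw_cons, ih, hf.branch_false_neg_one]

lemma one_add_gw_le (hf : IsControlled k ε f f') (w : List Bool) {x : ℝ}
    (hx : x ∈ Icc (-1 : ℝ) 1) : 1 + gw f w x ≤ k.C * k.lam ^ leadingZeros w := by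
  obtain ⟨y, hy, h⟩ := hf.exists_gw_eq_replicate w hx
  have h1 := hf.abs_sub_le_len (gw_mem_Iw f (List.replicate (leadingZeros w) false) hy)
    (gw_mem_Iw f _ neg_one_mem)
  have h2 := hf.decay (List.replicate (leadingZeros w) false)
  rw [hf.gw_replicate_neg_one] at h1
  rw [List.length_replicate] at h2
  rw [h]
  have := (le_abs_self _).trans (h1.trans h2)
  linarith

lemma min_gw_mem (hf : IsControlled k ε f f') (w : List Bool) :
    min (gw f w (-1)) (gw f w 1) ∈ Iw f w := by
  rw [hf.Iw_eq]
  exact ⟨le_rfl, min_le_max⟩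

lemma max_gw_mem (hf : IsControlled k ε f f') (w : List Bool) :
    max (gw f w (-1)) (gw f w 1) ∈ Iw f w := by
  rw [hf.Iw_eq]
  exact ⟨min_le_max, le_rfl⟩

lemma min_gw_le (hf : IsControlled k ε f f') {w : List Bool} {x : ℝ} (hx : x ∈ Iw f w) :
    min (gw f w (-1)) (gw f w 1) ≤ x := by
  rw [hf.Iw_eq] at hx
  exact hx.1

lemma neg_one_lt_of_mem (hf : IsControlled k ε f f') {w : List Bool} (hw : true ∈ w) {x : ℝ}
    (hx : x ∈ Iw f w) : -1 < x := by
  obtain ⟨y, hy, rfl⟩ := hx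
  exact hf.neg_one_lt_gw hw hy

lemma mem_side_of_mem_Iw (hf : IsControlled k ε f f') {b : Bool} {w : List Bool} {x : ℝ}
    (hx : x ∈ Iw f (b :: w)) : x ∈ side b := by
  obtain ⟨y, hy, rfl⟩ := hx
  exact hf.branch_mem b (hf.gw_mem w hy)

lemma relLen_nonneg (hf : IsControlled k ε f f') (w : List Bool) : 0 ≤ relLen f w := by
  refine div_nonneg (hf.len_pos w).le ?_
  linarith [(hf.Iw_subset w (hf.min_gw_mem w)).1]

lemma abs_sub_le_relLen (hf : IsControlled k ε f f') {w : List Bool} (hw : true ∈ w) {x y : ℝ}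
    (hx : x ∈ Iw f w) (hy : y ∈ Iw f w) : |x - y| ≤ relLen f w * (1 + x) := by
  have h1 := hf.neg_one_lt_of_mem hw (hf.min_gw_mem w)
  calc |x - y| ≤ len (Iw f w) := hf.abs_sub_le_len hx hy
    _ = relLen f w * (1 + min (gw f w (-1)) (gw f w 1)) := by
      rw [relLen, div_mul_cancel₀]
      linarith
    _ ≤ _ := mul_le_mul_of_nonneg_left (by linarith [hf.min_gw_le hx]) (hf.relLen_nonneg w)

lemma one_add_map_le (hf : IsControlled k ε f f') {b : Bool} {x : ℝ} (hx : x ∈ side b) :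
    1 + f x ≤ k.M * (1 - |x|) := by
  have hγ := k.γ_pos
  have h1 : sgn b * 1 ∈ side b := sgn_mul_mem_side (by norm_num)
  have h2 : f (sgn b * 1) = -1 := by cases b <;> simp [sgn, hf.map_neg_one, hf.map_one]
  have h3 : |sgn b * 1| = 1 := abs_sgn_mul zero_le_one
  have h := hf.upper_rpow hx h1 (by rw [h3]; exact (abs_mem_of_mem_side hx).2)
  rw [h2, h3, Real.one_rpow] at h
  have hB := one_add_mul_self_le_rpow_one_add (s := |x| - 1) (by linarith [abs_nonneg x])
    k.one_lt_γ.le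
  rw [add_sub_cancel] at hB
  have : k.M / k.γ * (1 - |x| ^ k.γ) ≤ k.M / k.γ * (k.γ * (1 - |x|)) :=
    mul_le_mul_of_nonneg_left (by linarith) (div_pos k.M_pos hγ).le
  rw [← mul_assoc, div_mul_cancel₀ _ hγ.ne'] at this
  linarith

lemma relLen_le_of_le (hf : IsControlled k ε f f') {w : List Bool} {c : ℝ}
    (h : ∀ x ∈ Iw f w, 1 ≤ c * (1 + x)) : relLen f w ≤ c * len (Iw f w) := by
  have h1 := h _ (hf.min_gw_mem w)
  have h2 := (hf.Iw_subset w (hf.min_gw_mem w)).1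
  have h3 : 0 < 1 + min (gw f w (-1)) (gw f w 1) := by
    refine lt_of_le_of_ne (by linarith) fun h0 => ?_
    rw [← h0] at h1
    linarith
  rw [relLen, div_le_iff₀ h3]
  nlinarith [hf.len_pos w]

lemma relLen_true_cons_le (hf : IsControlled k ε f f') (w : List Bool) :
    relLen f (true :: w) ≤ len (Iw f (true :: w)) := by
  have h := hf.relLen_le_of_le (w := true :: w) (c := 1) fun x hx => by
    linarith [(hf.mem_side_of_mem_Iw hx).1]
  rwa [one_mul] at h

lemma relLen_false_true_cons_le (hf : IsControlled k ε f f') (w : List Bool) :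
    relLen f (false :: true :: w) ≤ k.M * len (Iw f (false :: true :: w)) := by
  refine hf.relLen_le_of_le fun x hx => ?_
  have hs := hf.mem_side_of_mem_Iw hx
  have h := hf.one_add_map_le hs
  rw [abs_of_nonpos hs.2, sub_neg_eq_add] at h
  rw [IsUnimodal.Iw_cons] at hx
  obtain ⟨y, hy, rfl⟩ := hx
  rw [hf.map_branch _ (hf.Iw_subset _ hy)] at h
  linarith [(hf.mem_side_of_mem_Iw hy).1]

lemma relLen_false_cons_le (hf : IsControlled k ε f f') {w : List Bool} (hw : true ∈ w)
    (hw0 : ∀ x ∈ Iw f w, x ≤ 0) :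
    relLen f (false :: w) ≤ relLen f w * Real.exp (k.fixConst * k.θ ^ leadingZeros w) := by
  set p := min (gw f w (-1)) (gw f w 1) with hp
  set q := max (gw f w (-1)) (gw f w 1) with hq
  have hpI : p ∈ Iw f w := hf.min_gw_mem w
  have hqI : q ∈ Iw f w := hf.max_gw_mem w
  have hpm := hf.Iw_subset w hpI
  have hqm := hf.Iw_subset w hqI
  have hp1 := hf.neg_one_lt_of_mem hw hpI
  have hlenw : len (Iw f w) = q - p := by rw [hf.len_Iw, max_sub_min_eq_abs]
  have hpq : p < q := by
    have := hf.len_pos w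
    linarith
  have hmono := hf.strictMonoOn_branch_false
  have hmin : min (gw f (false :: w) (-1)) (gw f (false :: w) 1) = branch f false p := by
    rw [gw_cons, gw_cons, hp]
    exact (hmono.monotoneOn.map_min (hf.gw_mem w neg_one_mem) (hf.gw_mem w one_mem)).symm
  have hmax : max (gw f (false :: w) (-1)) (gw f (false :: w) 1) = branch f false q := by
    rw [gw_cons, gw_cons, hq]
    exact (hmono.monotoneOn.map_max (hf.gw_mem w neg_one_mem) (hf.gw_mem w one_mem)).symm
  have hlen : len (Iw f (false :: w)) = branch f false q - branch f false p := by
    rw [hf.len_Iw, ← max_sub_min_eq_abs, hmin, hmax]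
  obtain ⟨z, hz, hz0, hzeq⟩ := hf.exists_abs_sub_eq false hqm hpm hpq.ne'
  obtain ⟨z', hz', hz0', hzeq'⟩ := hf.exists_abs_sub_eq false hpm neg_one_mem hp1.ne'
  have hbp : -1 < branch f false p := by
    have := hmono neg_one_mem hpm hp1
    rwa [hf.branch_false_neg_one] at this
  have hbpq := hmono hpm hqm hpq
  rw [uIcc_comm, uIcc_of_le hpq.le] at hz
  rw [uIcc_comm, uIcc_of_le hp1.le] at hz'
  have hq0 := hw0 q hqI
  have hzm : z ∈ Icc (-1 : ℝ) 0 := ⟨hp1.le.trans hz.1, hz.2.trans hq0⟩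
  have hzm' : z' ∈ Icc (-1 : ℝ) 0 := ⟨hz'.1, hz'.2.trans (hpq.le.trans hq0)⟩
  have hs : Icc (-1 : ℝ) 0 ⊆ Icc (-1) 1 := side_subset false
  have hd := hf.log_deriv_sub_le_of_nonpos false hzm' hzm
  have hbz : ∀ t ∈ Icc (-1 : ℝ) 0, t ≤ q → branch f false t ∈ Icc (-1) (branch f false q) :=
    fun t ht htq => ⟨(hf.branch_mem_Icc false (hs ht)).1, hmono.monotoneOn (hs ht) hqm htq⟩
  have hbq : 1 + branch f false q ≤ k.C * k.lam ^ leadingZeros (false :: w) := by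
    rcases max_choice (gw f w (-1)) (gw f w 1) with h | h <;> rw [hq, h]
    · exact hf.one_add_gw_le (false :: w) neg_one_mem
    · exact hf.one_add_gw_le (false :: w) one_mem
  have hqle : 1 + q ≤ k.C * k.lam ^ leadingZeros w := by
    rcases max_choice (gw f w (-1)) (gw f w 1) with h | h <;> rw [hq, h]
    · exact hf.one_add_gw_le w neg_one_mem
    · exact hf.one_add_gw_le w one_mem
  have hb1 := hbz z hzm hz.2
  have hb2 := hbz z' hzm' (hz'.2.trans hpq.le)
  have hd1 : |branch f false z' - branch f false z| ^ k.α ≤ k.C ^ k.α * k.θ ^ leadingZeros w := by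
    refine (k.rpow_le_of_le_decay (n := leadingZeros (false :: w)) (abs_nonneg _) ?_).trans
      (mul_le_mul_of_nonneg_left (k.θ_pow_le (Nat.le_succ _)) (Real.rpow_nonneg k.C_pos.le _))
    refine le_trans ?_ hbq
    rw [abs_le]
    constructor <;> linarith [hb1.1, hb1.2, hb2.1, hb2.2]
  have hd2 : |z' - z| ≤ k.C * k.θ ^ leadingZeros w := by
    refine le_trans ?_ (hqle.trans (mul_le_mul_of_nonneg_left (k.lam_pow_le _) k.C_pos.le))
    rw [abs_le]
    constructor <;> linarith [hz.1, hz.2, hz'.1, hz'.2]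
  have hδ : Real.log (f' (branch f false z')) - Real.log (f' (branch f false z)) ≤
      k.fixConst * k.θ ^ leadingZeros w := by
    refine (le_abs_self _).trans (hd.trans ?_)
    have e1 := mul_le_mul_of_nonneg_left hd1 k.H_nonneg
    have e2 := mul_le_mul_of_nonneg_left hd2 k.critFactor_nonneg
    rw [DistortionConstants.fixConst]
    linarith
  have hz1 := hf.abs_deriv_pos (hf.branch_mem false (hs hzm)) hz0
  have hz2 := hf.abs_deriv_pos (hf.branch_mem false (hs hzm')) hz0'
  have hexp : |f' (branch f false z')| ≤
      |f' (branch f false z)| * Real.exp (k.fixConst * k.θ ^ leadingZeros w) := by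
    rw [← Real.exp_log hz1, ← Real.exp_log hz2, ← Real.exp_add, Real.log_abs, Real.log_abs]
    exact Real.exp_le_exp.2 (by linarith)
  rw [abs_of_pos (sub_pos.2 hpq), abs_of_pos (sub_pos.2 hbpq)] at hzeq
  rw [hf.branch_false_neg_one, sub_neg_eq_add, sub_neg_eq_add,
    abs_of_pos (show 0 < p + 1 by linarith),
    abs_of_pos (show 0 < branch f false p + 1 by linarith)] at hzeq'
  rw [relLen, relLen, hlen, hmin, hlenw, ← hp, hzeq, add_comm 1 p, hzeq', add_comm 1]
  have hx : 0 < branch f false p + 1 := by linarith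
  have hy : 0 < branch f false q - branch f false p := by linarith
  rw [mul_div_mul_comm, mul_right_comm]
  refine le_mul_of_one_le_left (div_pos hy hx).le ?_
  rw [div_mul_eq_mul_div, one_le_div hz2]
  exact hexp

lemma relLen_le_potential (hf : IsControlled k ε f f') (w : List Bool) :
    relLen f w ≤ potential k f w :=
  le_mul_of_one_le_right (hf.relLen_nonneg w) (Real.one_le_exp
    (mul_nonneg k.runConst_nonneg (pow_nonneg k.θ_pos.le _)))

lemma potential_nonneg (hf : IsControlled k ε f f') (w : List Bool) : 0 ≤ potential k f w :=
  (hf.relLen_nonneg w).trans (hf.relLen_le_potential w)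

lemma potential_le (hf : IsControlled k ε f f') {w : List Bool}
    (h : relLen f w ≤ (1 + k.M) * len (Iw f w)) :
    potential k f w ≤ k.potConst * len (Iw f w) := by
  have h1 : Real.exp (k.runConst * k.θ ^ leadingZeros w) ≤ Real.exp k.runConst :=
    Real.exp_le_exp.2 (mul_le_of_le_one_right k.runConst_nonneg
      (pow_le_one₀ k.θ_pos.le k.θ_lt_one.le))
  calc potential k f w ≤ relLen f w * Real.exp k.runConst :=
        mul_le_mul_of_nonneg_left h1 (hf.relLen_nonneg w)
    _ ≤ (1 + k.M) * len (Iw f w) * Real.exp k.runConst :=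
        mul_le_mul_of_nonneg_right h (Real.exp_pos _).le
    _ = _ := by rw [DistortionConstants.potConst]; ring

lemma potential_true_cons_le (hf : IsControlled k ε f f') (w : List Bool) :
    potential k f (true :: w) ≤ k.potConst * len (Iw f (true :: w)) := by
  refine hf.potential_le ((hf.relLen_true_cons_le w).trans ?_)
  nlinarith [hf.len_pos (true :: w), k.M_pos]

lemma potential_false_false_cons_le (hf : IsControlled k ε f f') {w : List Bool}
    (hw : true ∈ w) : potential k f (false :: false :: w) ≤ potential k f (false :: w) := by
  have h := hf.relLen_false_cons_le (w := false :: w) (List.mem_cons_of_mem _ hw)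
    fun x hx => (hf.mem_side_of_mem_Iw hx).2
  refine (mul_le_mul_of_nonneg_right h (Real.exp_pos _).le).trans ?_
  rw [mul_assoc, ← Real.exp_add]
  refine mul_le_mul_of_nonneg_left (Real.exp_le_exp.2 (le_of_eq ?_)) (hf.relLen_nonneg _)
  have : (1 - k.θ) ≠ 0 := (sub_pos.2 k.θ_lt_one).ne'
  simp only [leadingZeros, DistortionConstants.runConst, pow_succ]
  field_simp
  ring

/-- Prepending a letter: the potential pays for the relative length at a folding step. -/
lemma potential_cons_le (hf : IsControlled k ε f f') (c : Bool) {w : List Bool} (hw : true ∈ w) :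
    (if c then relLen f w else 0) + potential k f (c :: w) ≤
      potential k f w + k.potConst * len (Iw f (c :: w)) := by
  cases c
  · rw [if_neg Bool.false_ne_true, zero_add]
    have hnn := mul_nonneg k.potConst_nonneg (hf.len_pos (false :: w)).le
    match w, hw with
    | true :: w, _ =>
      have h1 := hf.potential_le (w := false :: true :: w)
        ((hf.relLen_false_true_cons_le w).trans (by
          nlinarith [hf.len_pos (false :: true :: w), k.M_pos]))
      linarith [hf.potential_nonneg (true :: w)]
    | false :: w, hw =>
      linarith [hf.potential_false_false_cons_le (w := w) (by simpa using hw)]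
  · rw [if_pos rfl]
    exact add_le_add (hf.relLen_le_potential w) (hf.potential_true_cons_le w)

end IsControlled

/-- The word of the coordinates `n, …, 1` of a dual point. -/
def innerWord (a : ℕ → Bool) : ℕ → List Bool
  | 0 => []
  | n + 1 => a (n + 1) :: innerWord a n

lemma word_eq (a : ℕ → Bool) (n : ℕ) : word a n = innerWord a n ++ [a 0] := by
  induction n with
  | zero => rfl
  | succ n ih =>
    rw [innerWord, List.cons_append, ← ih, word, List.range_succ, List.reverse_append]
    rfl

lemma length_innerWord (a : ℕ → Bool) (n : ℕ) : (innerWord a n).length = n := by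
  induction n with
  | zero => rfl
  | succ n ih => rw [innerWord, List.length_cons, ih]

lemma innerWord_congr {a b : ℕ → Bool} {n : ℕ} (h : ∀ i ≤ n, a i = b i) :
    innerWord a n = innerWord b n := by
  induction n with
  | zero => rfl
  | succ n ih => rw [innerWord, innerWord, h _ le_rfl, ih fun i hi => h i (by omega)]

lemma mem_innerWord {a : ℕ → Bool} {m n : ℕ} (hm : 1 ≤ m) (hmn : m ≤ n) :
    a m ∈ innerWord a n := by
  induction n with
  | zero => omega
  | succ n ih =>
    rcases hmn.eq_or_lt with rfl | h
    · exact List.mem_cons_self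
    · exact List.mem_cons_of_mem _ (ih (by omega))

/-- The logarithm of the ratio of the distances of the images of two pairs of points. -/
noncomputable def logRatio (f : ℝ → ℝ) (w : List Bool) (p q r s : ℝ) : ℝ :=
  Real.log (gw f w p - gw f w q) - Real.log (gw f w r - gw f w s)

namespace IsControlled

variable {k : DistortionConstants} {ε : ℝ} {f f' : ℝ → ℝ}

lemma abs_sub_le_foldConst (hf : IsControlled k ε f f') {w : List Bool} (hw : true ∈ w)
    {x y : ℝ} (hx : x ∈ Iw f (true :: w)) (hy : y ∈ Iw f (true :: w)) (hxy : x ≤ y)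
    (hy2 : 1 / 2 ≤ y) : y - x ≤ k.foldConst * relLen f w * (1 - y) := by
  have hγ := k.γ_pos
  have hm := k.m_pos
  have hM := k.M_pos
  have hxs := hf.mem_side_of_mem_Iw hx
  have hys := hf.mem_side_of_mem_Iw hy
  have hx0 := hxs.1
  have hlow := hf.lower_rpow hxs hys (by rwa [abs_of_nonneg hx0, abs_of_nonneg hys.1])
  rw [abs_of_nonneg hx0, abs_of_nonneg hys.1] at hlow
  have hup := hf.one_add_map_le hys
  rw [abs_of_nonneg hys.1] at hup
  have hrel : f x - f y ≤ relLen f w * (1 + f y) := by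
    rw [IsUnimodal.Iw_cons] at hx hy
    obtain ⟨z, hz, rfl⟩ := hx
    obtain ⟨z', hz', rfl⟩ := hy
    rw [hf.map_branch _ (hf.Iw_subset w hz), hf.map_branch _ (hf.Iw_subset w hz')]
    exact (neg_sub z' z).symm.le.trans ((neg_le_abs _).trans (hf.abs_sub_le_relLen hw hz' hz))
  have hrel2 := hrel.trans (mul_le_mul_of_nonneg_left hup (hf.relLen_nonneg w))
  have hpow : (1 / 2) ^ (k.γ - 1) * (y - x) ≤ y ^ k.γ - x ^ k.γ := by
    have hy0 : 0 < y := by linarith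
    have e1 : (1 / 2 : ℝ) ^ (k.γ - 1) ≤ y ^ (k.γ - 1) :=
      Real.rpow_le_rpow (by norm_num) hy2 (by linarith [k.one_lt_γ])
    have e2 : y ^ k.γ = y * y ^ (k.γ - 1) := by
      rw [← Real.rpow_one_add' hy0.le (by linarith), add_sub_cancel]
    have e3 : x ^ k.γ = x * x ^ (k.γ - 1) := by
      rw [← Real.rpow_one_add' hx0 (by linarith), add_sub_cancel]
    have e4 : x ^ (k.γ - 1) ≤ y ^ (k.γ - 1) :=
      Real.rpow_le_rpow hx0 hxy (by linarith [k.one_lt_γ])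
    have e5 := mul_le_mul_of_nonneg_left e4 hx0
    have e6 := mul_le_mul_of_nonneg_right e1 (sub_nonneg.2 hxy)
    rw [e2, e3]
    linarith
  have hc : 0 < k.m / k.γ * (1 / 2) ^ (k.γ - 1) := by positivity
  refine le_of_mul_le_mul_left ?_ hc
  calc k.m / k.γ * (1 / 2) ^ (k.γ - 1) * (y - x)
      = k.m / k.γ * ((1 / 2) ^ (k.γ - 1) * (y - x)) := by ring
    _ ≤ k.m / k.γ * (y ^ k.γ - x ^ k.γ) := mul_le_mul_of_nonneg_left hpow (by positivity)
    _ ≤ relLen f w * (k.M * (1 - y)) := hlow.trans hrel2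
    _ = _ := by
      rw [DistortionConstants.foldConst]
      have : (1 / 2 : ℝ) ^ (k.γ - 1) ≠ 0 := by positivity
      field_simp

lemma abs_sub_le_one_sub_max (hf : IsControlled k ε f f') {c : Bool} {w : List Bool}
    (hw : c = true → true ∈ w) {x y : ℝ} (hx : x ∈ Iw f (c :: w)) (hy : y ∈ Iw f (c :: w)) :
    |x - y| ≤ (2 * len (Iw f (c :: w)) + k.foldConst * if c then relLen f w else 0) *
      (1 - max x y) := by
  wlog hxy : x ≤ y generalizing x y
  · rw [abs_sub_comm, max_comm]
    exact this hy hx (le_of_not_ge hxy)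
  have hlen := hf.len_pos (c :: w)
  have hd := hf.abs_sub_le_len hx hy
  have hys := hf.mem_side_of_mem_Iw hy
  have hpos : 0 ≤ k.foldConst * if c then relLen f w else 0 := by
    refine mul_nonneg k.foldConst_nonneg ?_
    split_ifs
    exacts [hf.relLen_nonneg w, le_rfl]
  have hy1 : y ≤ 1 := (side_subset c hys).2
  rw [max_eq_right hxy, add_mul]
  rcases le_or_gt (1 / 2) y with h | h
  · cases c
    · linarith [hys.2]
    · have := hf.abs_sub_le_foldConst (hw rfl) hx hy hxy h
      rw [abs_sub_comm, abs_of_nonneg (sub_nonneg.2 hxy), if_pos rfl]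
      nlinarith
  · nlinarith [mul_nonneg hpos (sub_nonneg.2 hy1)]

lemma log_deriv_sub_le_stepConst (hf : IsControlled k ε f f') (b c : Bool) {w : List Bool}
    (hw : c = true → true ∈ w) {x y : ℝ} (hx : x ∈ Iw f (c :: w)) (hy : y ∈ Iw f (c :: w))
    (hx0 : branch f b x ≠ 0) (hy0 : branch f b y ≠ 0) :
    |Real.log (f' (branch f b x)) - Real.log (f' (branch f b y))| ≤
      k.stepConst * (k.θ ^ w.length + if c then relLen f w else 0) := by
  have hχ : 0 ≤ if c then relLen f w else 0 := by
    split_ifs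
    exacts [hf.relLen_nonneg w, le_rfl]
  have hlen := hf.len_pos (c :: w)
  have hE : 0 ≤ 2 * len (Iw f (c :: w)) + k.foldConst * if c then relLen f w else 0 :=
    add_nonneg (by linarith) (mul_nonneg k.foldConst_nonneg hχ)
  refine (hf.log_deriv_sub_le b (hf.Iw_subset _ hx) (hf.Iw_subset _ hy) hx0 hy0 hE
    (hf.abs_sub_le_one_sub_max hw hx hy)).trans ?_
  have h1 : |branch f b x - branch f b y| ≤ len (Iw f (b :: c :: w)) := by
    rw [IsUnimodal.Iw_cons f b]
    have e1 := mem_image_of_mem (branch f b) hx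
    have e2 := mem_image_of_mem (branch f b) hy
    rw [← IsUnimodal.Iw_cons f b] at e1 e2 ⊢
    exact hf.abs_sub_le_len e1 e2
  have hθ : 0 ≤ k.θ ^ w.length := pow_nonneg k.θ_pos.le _
  have h2 := (k.rpow_le_of_le_decay (abs_nonneg _) (h1.trans (hf.decay _))).trans
    (mul_le_mul_of_nonneg_left (k.θ_pow_le (i := w.length) (by simp; omega))
      (Real.rpow_nonneg k.C_pos.le _))
  have h3 := hf.len_le (c :: w) (n := w.length) (by simp)
  have h4 := mul_le_mul_of_nonneg_left h2 k.H_nonneg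
  have h5 : k.critFactor * (2 * len (Iw f (c :: w)) + k.foldConst * if c then relLen f w else 0) ≤
      k.critFactor * ((2 * k.C + k.foldConst) *
        (k.θ ^ w.length + if c then relLen f w else 0)) := by
    refine mul_le_mul_of_nonneg_left ?_ k.critFactor_nonneg
    nlinarith [mul_nonneg k.C_pos.le hχ, mul_nonneg k.foldConst_nonneg hθ]
  have h6 : 0 ≤ k.H * k.C ^ k.α * if c then relLen f w else 0 :=
    mul_nonneg (mul_nonneg k.H_nonneg (Real.rpow_nonneg k.C_pos.le _)) hχ
  rw [DistortionConstants.stepConst]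
  linarith

lemma abs_logRatio_cons_sub_le (hf : IsControlled k ε f f') (b c : Bool) {w : List Bool}
    (hw : c = true → true ∈ w) {p q r s : ℝ} (hp : p ∈ Icc (-1 : ℝ) 1)
    (hq : q ∈ Icc (-1 : ℝ) 1) (hr : r ∈ Icc (-1 : ℝ) 1) (hs : s ∈ Icc (-1 : ℝ) 1)
    (hpq : p ≠ q) (hrs : r ≠ s) :
    |logRatio f (b :: c :: w) p q r s - logRatio f (c :: w) p q r s| ≤
      k.stepConst * (k.θ ^ w.length + if c then relLen f w else 0) := by
  have key : ∀ p ∈ Icc (-1 : ℝ) 1, ∀ q ∈ Icc (-1 : ℝ) 1, p ≠ q → ∃ z ∈ Iw f (c :: w),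
      branch f b z ≠ 0 ∧ Real.log (gw f (c :: w) p - gw f (c :: w) q) =
        Real.log (f' (branch f b z)) +
          Real.log (gw f (b :: c :: w) p - gw f (b :: c :: w) q) := by
    intro p hp q hq hpq
    obtain ⟨z, hz, hz0, h⟩ := hf.exists_abs_sub_eq b (hf.gw_mem (c :: w) hp)
      (hf.gw_mem (c :: w) hq) fun h => hpq (hf.gw_injOn _ hp hq h)
    have hzI : z ∈ Iw f (c :: w) := by
      have e1 := gw_mem_Iw f (c :: w) hp
      have e2 := gw_mem_Iw f (c :: w) hq
      rw [hf.Iw_eq] at e1 e2 ⊢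
      exact uIcc_subset_uIcc e1 e2 hz
    have hd := hf.abs_deriv_pos (hf.branch_mem b (hf.Iw_subset _ hzI)) hz0
    have hne : branch f b (gw f (c :: w) p) - branch f b (gw f (c :: w) q) ≠ 0 :=
      sub_ne_zero.2 fun h => hpq (hf.gw_injOn (b :: c :: w) hp hq h)
    refine ⟨z, hzI, hz0, ?_⟩
    rw [← Real.log_abs, h, Real.log_mul hd.ne' (abs_pos.2 hne).ne', Real.log_abs, Real.log_abs]
    rfl
  obtain ⟨z, hz, hz0, h1⟩ := key p hp q hq hpq
  obtain ⟨z', hz', hz0', h2⟩ := key r hr s hs hrs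
  have h3 := hf.log_deriv_sub_le_stepConst b c hw hz' hz hz0' hz0
  rw [logRatio, logRatio, h1, h2]
  convert h3 using 2
  ring

/-- Total distortion along a dual point, from a coordinate equal to `1` on. -/
lemma abs_logRatio_sub_le_of_true (hf : IsControlled k ε f f') {a : ℕ → Bool} {m : ℕ}
    (hm : 1 ≤ m) (ham : a m = true) {p q r s : ℝ} (hp : p ∈ Icc (-1 : ℝ) 1)
    (hq : q ∈ Icc (-1 : ℝ) 1) (hr : r ∈ Icc (-1 : ℝ) 1) (hs : s ∈ Icc (-1 : ℝ) 1)
    (hpq : p ≠ q) (hrs : r ≠ s) (j : ℕ) :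
    |logRatio f (innerWord a (m + 1 + j)) p q r s - logRatio f (innerWord a (m + 1)) p q r s| ≤
      k.stepConst * (k.potConst * k.C + (1 + k.potConst * k.C) / (1 - k.θ)) * k.θ ^ m := by
  have hθ1 : 0 < 1 - k.θ := sub_pos.2 k.θ_lt_one
  have hS := k.stepConst_nonneg
  have hPC : 0 ≤ k.potConst * k.C := mul_nonneg k.potConst_nonneg k.C_pos.le
  have hmem : ∀ n, m ≤ n → true ∈ innerWord a n := fun n hn => ham ▸ mem_innerWord hm hn
  have main : ∀ j, |logRatio f (innerWord a (m + 1 + j)) p q r s -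
      logRatio f (innerWord a (m + 1)) p q r s| +
        k.stepConst * potential k f (innerWord a (m + j)) ≤
      k.stepConst * potential k f (innerWord a m) +
        k.stepConst * ((1 + k.potConst * k.C) / (1 - k.θ)) * (k.θ ^ m - k.θ ^ (m + j)) := by
    intro j
    induction j with
    | zero => simp
    | succ j ih =>
      set c := a (m + j + 1)
      have hw := hmem (m + j) (by omega)
      have h1 := hf.abs_logRatio_cons_sub_le (a (m + 1 + j + 1)) c (fun _ => hw) hp hq hr hs
        hpq hrs
      have e1 : innerWord a (m + 1 + (j + 1)) =
          a (m + 1 + j + 1) :: c :: innerWord a (m + j) := by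
        rw [show m + 1 + (j + 1) = m + j + 1 + 1 by ring, innerWord, innerWord,
          show m + 1 + j + 1 = m + j + 1 + 1 by ring]
      have e2 : innerWord a (m + 1 + j) = c :: innerWord a (m + j) := by
        rw [show m + 1 + j = m + j + 1 by ring, innerWord]
      have e3 : innerWord a (m + (j + 1)) = c :: innerWord a (m + j) := rfl
      rw [← e1, ← e2, length_innerWord] at h1
      have h2 := hf.potential_cons_le c hw
      have h3 := hf.len_le (c :: innerWord a (m + j)) (n := m + j) (by simp [length_innerWord])
      have h4 := mul_le_mul_of_nonneg_left h3 k.potConst_nonneg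
      have h5 := abs_sub_le (logRatio f (innerWord a (m + 1 + (j + 1))) p q r s)
        (logRatio f (innerWord a (m + 1 + j)) p q r s) (logRatio f (innerWord a (m + 1)) p q r s)
      have h6 : k.stepConst * ((if c then relLen f (innerWord a (m + j)) else 0) +
          potential k f (c :: innerWord a (m + j))) ≤
          k.stepConst * (potential k f (innerWord a (m + j)) +
            k.potConst * (k.C * k.θ ^ (m + j))) :=
        mul_le_mul_of_nonneg_left (by linarith) hS
      have h7 : k.stepConst * ((1 + k.potConst * k.C) / (1 - k.θ)) *
          (k.θ ^ m - k.θ ^ (m + (j + 1))) = k.stepConst * ((1 + k.potConst * k.C) / (1 - k.θ)) *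
          (k.θ ^ m - k.θ ^ (m + j)) + k.stepConst * (1 + k.potConst * k.C) * k.θ ^ (m + j) := by
        rw [← add_assoc, pow_succ]
        field_simp
        ring
      rw [h7, e3]
      linarith
  have h1 := main j
  have h2 : potential k f (innerWord a m) ≤ k.potConst * k.C * k.θ ^ m := by
    obtain ⟨n, rfl⟩ : ∃ n, m = n + 1 := ⟨m - 1, by omega⟩
    have h3 := hf.len_le (innerWord a (n + 1)) (n := n + 1) (by simp [length_innerWord])
    rw [innerWord, ham] at h3 ⊢
    have := (hf.potential_true_cons_le _).trans (mul_le_mul_of_nonneg_left h3 k.potConst_nonneg)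
    linarith
  have h3 := mul_le_mul_of_nonneg_left h2 hS
  have h4 := mul_nonneg hS (hf.potential_nonneg (innerWord a (m + j)))
  have h5 : 0 ≤ k.stepConst * ((1 + k.potConst * k.C) / (1 - k.θ)) * k.θ ^ (m + j) :=
    mul_nonneg (mul_nonneg hS (div_nonneg (by linarith) hθ1.le)) (pow_nonneg k.θ_pos.le _)
  linarith

/-- Total distortion along a dual point, from a place on after which all coordinates vanish. -/
lemma abs_logRatio_sub_le_of_false (hf : IsControlled k ε f f') {a : ℕ → Bool} {m : ℕ}
    (ham : ∀ i, m < i → a i = false) {p q r s : ℝ} (hp : p ∈ Icc (-1 : ℝ) 1)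
    (hq : q ∈ Icc (-1 : ℝ) 1) (hr : r ∈ Icc (-1 : ℝ) 1) (hs : s ∈ Icc (-1 : ℝ) 1)
    (hpq : p ≠ q) (hrs : r ≠ s) (j : ℕ) :
    |logRatio f (innerWord a (m + 1 + j)) p q r s - logRatio f (innerWord a (m + 1)) p q r s| ≤
      k.stepConst / (1 - k.θ) * k.θ ^ m := by
  have hθ1 : 0 < 1 - k.θ := sub_pos.2 k.θ_lt_one
  have main : ∀ j, |logRatio f (innerWord a (m + 1 + j)) p q r s -
      logRatio f (innerWord a (m + 1)) p q r s| ≤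
        k.stepConst / (1 - k.θ) * (k.θ ^ m - k.θ ^ (m + j)) := by
    intro j
    induction j with
    | zero => simp
    | succ j ih =>
      have h1 := hf.abs_logRatio_cons_sub_le (a (m + 1 + j + 1)) false
        (w := innerWord a (m + j)) (fun h => by simp at h) hp hq hr hs hpq hrs
      have e1 : innerWord a (m + 1 + (j + 1)) =
          a (m + 1 + j + 1) :: false :: innerWord a (m + j) := by
        rw [show m + 1 + (j + 1) = m + j + 1 + 1 by ring, innerWord, innerWord,
          show m + 1 + j + 1 = m + j + 1 + 1 by ring, ham (m + j + 1) (by omega)]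
      have e2 : innerWord a (m + 1 + j) = false :: innerWord a (m + j) := by
        rw [show m + 1 + j = m + j + 1 by ring, innerWord, ham (m + j + 1) (by omega)]
      rw [← e1, ← e2, length_innerWord, if_neg Bool.false_ne_true, add_zero] at h1
      have h5 := abs_sub_le (logRatio f (innerWord a (m + 1 + (j + 1))) p q r s)
        (logRatio f (innerWord a (m + 1 + j)) p q r s) (logRatio f (innerWord a (m + 1)) p q r s)
      have h7 : k.stepConst / (1 - k.θ) * (k.θ ^ m - k.θ ^ (m + (j + 1))) =
          k.stepConst / (1 - k.θ) * (k.θ ^ m - k.θ ^ (m + j)) + k.stepConst * k.θ ^ (m + j) := by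
        rw [← add_assoc, pow_succ]
        field_simp
        ring
      rw [h7]
      linarith
  have h5 : 0 ≤ k.stepConst / (1 - k.θ) * k.θ ^ (m + j) :=
    mul_nonneg (div_nonneg k.stepConst_nonneg hθ1.le) (pow_nonneg k.θ_pos.le _)
  linarith [main j]

end IsControlled

/-- The ratio of the lengths of the images of two intervals under an inverse branch. -/
noncomputable def lenRatio (f : ℝ → ℝ) (w : List Bool) (p q r s : ℝ) : ℝ :=
  |gw f w p - gw f w q| / |gw f w r - gw f w s|

/-- The total distortion along a dual point is at most `distConst * θ ^ m`. -/
noncomputable def DistortionConstants.distConst (k : DistortionConstants) : ℝ :=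
  k.stepConst * (k.potConst * k.C + (1 + k.potConst * k.C) / (1 - k.θ))

namespace IsControlled

variable {k : DistortionConstants} {ε : ℝ} {f f' : ℝ → ℝ}

lemma ratio_eq (hf : IsControlled k ε f f') (a : ℕ → Bool) (n : ℕ) :
    ratio f a n =
      lenRatio f (innerWord a n) (branch f (a 0) 1) (branch f (a 0) (-1)) 1 (-1) := by
  rw [ratio, word_eq, List.dropLast_concat, hf.len_Iw, hf.len_Iw, lenRatio, gw_append, gw_append]
  rfl

lemma branch_ne (hf : IsControlled k ε f f') (b : Bool) : branch f b 1 ≠ branch f b (-1) :=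
  fun h => by have := hf.branch_injOn b one_mem neg_one_mem h; norm_num at this

lemma exp_logRatio (hf : IsControlled k ε f f') (w : List Bool) {p q r s : ℝ}
    (hp : p ∈ Icc (-1 : ℝ) 1) (hq : q ∈ Icc (-1 : ℝ) 1) (hr : r ∈ Icc (-1 : ℝ) 1)
    (hs : s ∈ Icc (-1 : ℝ) 1) (hpq : p ≠ q) (hrs : r ≠ s) :
    Real.exp (logRatio f w p q r s) = lenRatio f w p q r s := by
  have h1 := abs_pos.2 (sub_ne_zero.2 fun h => hpq (hf.gw_injOn w hp hq h))
  have h2 := abs_pos.2 (sub_ne_zero.2 fun h => hrs (hf.gw_injOn w hr hs h))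
  rw [logRatio, ← Real.log_abs, ← Real.log_abs (gw f w r - gw f w s), Real.exp_sub,
    Real.exp_log h1, Real.exp_log h2, lenRatio]

lemma ratio_le_of_logRatio (hf : IsControlled k ε f f') (a : ℕ → Bool) {m n : ℕ} {e : ℝ}
    (h : |logRatio f (innerWord a n) (branch f (a 0) 1) (branch f (a 0) (-1)) 1 (-1) -
      logRatio f (innerWord a m) (branch f (a 0) 1) (branch f (a 0) (-1)) 1 (-1)| ≤ e) :
    ratio f a n ≤ Real.exp e * ratio f a m ∧ ratio f a m ≤ Real.exp e * ratio f a n := by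
  have hx := hf.branch_mem_Icc (a 0) one_mem
  have hy := hf.branch_mem_Icc (a 0) neg_one_mem
  have h1 : (1 : ℝ) ≠ -1 := by norm_num
  rw [hf.ratio_eq, hf.ratio_eq, ← hf.exp_logRatio _ hx hy one_mem neg_one_mem (hf.branch_ne _) h1,
    ← hf.exp_logRatio _ hx hy one_mem neg_one_mem (hf.branch_ne _) h1, ← Real.exp_add,
    ← Real.exp_add]
  obtain ⟨h2, h3⟩ := abs_le.1 h
  exact ⟨Real.exp_le_exp.2 (by linarith), Real.exp_le_exp.2 (by linarith)⟩

lemma ratio_le_of_true (hf : IsControlled k ε f f') {a : ℕ → Bool} {m : ℕ} (hm : 1 ≤ m)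
    (ham : a m = true) (j : ℕ) :
    ratio f a (m + 1 + j) ≤ Real.exp (k.distConst * k.θ ^ m) * ratio f a (m + 1) ∧
      ratio f a (m + 1) ≤ Real.exp (k.distConst * k.θ ^ m) * ratio f a (m + 1 + j) :=
  hf.ratio_le_of_logRatio a <| hf.abs_logRatio_sub_le_of_true hm ham
    (hf.branch_mem_Icc _ one_mem) (hf.branch_mem_Icc _ neg_one_mem) one_mem neg_one_mem
    (hf.branch_ne _) (by norm_num) j

lemma ratio_le_of_false (hf : IsControlled k ε f f') {a : ℕ → Bool} {m : ℕ}
    (ha : ∀ i > m, a i = false) (j : ℕ) :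
    ratio f a (m + 1 + j) ≤ Real.exp (k.stepConst / (1 - k.θ) * k.θ ^ m) * ratio f a (m + 1) ∧
      ratio f a (m + 1) ≤ Real.exp (k.stepConst / (1 - k.θ) * k.θ ^ m) * ratio f a (m + 1 + j) :=
  hf.ratio_le_of_logRatio a <| hf.abs_logRatio_sub_le_of_false ha
    (hf.branch_mem_Icc _ one_mem) (hf.branch_mem_Icc _ neg_one_mem) one_mem neg_one_mem
    (hf.branch_ne _) (by norm_num) j

lemma scaling_le_of_true (hf : IsControlled k ε f f') {s : (ℕ → Bool) → ℝ}
    (hs : IsScalingFun f s) {a : ℕ → Bool} {m : ℕ} (hm : 1 ≤ m) (ham : a m = true) :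
    s a ≤ Real.exp (k.distConst * k.θ ^ m) * ratio f a (m + 1) ∧
      ratio f a (m + 1) ≤ Real.exp (k.distConst * k.θ ^ m) * s a := by
  have h : Tendsto (fun j => ratio f a (m + 1 + j)) atTop (𝓝 (s a)) := by
    simpa only [add_comm] using (tendsto_add_atTop_iff_nat (m + 1)).2 (hs a)
  exact ⟨le_of_tendsto' h fun j => (hf.ratio_le_of_true hm ham j).1,
    ge_of_tendsto' (h.const_mul _) fun j => (hf.ratio_le_of_true hm ham j).2⟩

lemma scaling_le_of_false (hf : IsControlled k ε f f') {s : (ℕ → Bool) → ℝ}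
    (hs : IsScalingFun f s) {a : ℕ → Bool} {m : ℕ} (ha : ∀ i > m, a i = false) :
    s a ≤ Real.exp (k.stepConst / (1 - k.θ) * k.θ ^ m) * ratio f a (m + 1) ∧
      ratio f a (m + 1) ≤ Real.exp (k.stepConst / (1 - k.θ) * k.θ ^ m) * s a := by
  have h : Tendsto (fun j => ratio f a (m + 1 + j)) atTop (𝓝 (s a)) := by
    simpa only [add_comm] using (tendsto_add_atTop_iff_nat (m + 1)).2 (hs a)
  exact ⟨le_of_tendsto' h fun j => (hf.ratio_le_of_false ha j).1,
    ge_of_tendsto' (h.const_mul _) fun j => (hf.ratio_le_of_false ha j).2⟩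

end IsControlled

lemma abs_log_sub_log_le {c u v : ℝ} (hc : 0 < c) (hu : c ≤ u) (hv : c ≤ v) :
    |Real.log u - Real.log v| ≤ |u - v| / c := by
  have key : ∀ u v : ℝ, c ≤ u → c ≤ v → Real.log u - Real.log v ≤ |u - v| / c := by
    intro u v hu hv
    have hv0 := hc.trans_le hv
    have hu0 := hc.trans_le hu
    rw [← Real.log_div hu0.ne' hv0.ne']
    calc Real.log (u / v) ≤ u / v - 1 := Real.log_le_sub_one_of_pos (div_pos hu0 hv0)
      _ = (u - v) / v := by field_simp
      _ ≤ |u - v| / v := by gcongr; exact le_abs_self _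
      _ ≤ |u - v| / c := by gcongr
  rw [abs_le]
  have h1 := key u v hu hv
  have h2 := key v u hv hu
  rw [abs_sub_comm] at h2
  constructor <;> linarith

namespace GoodFamily

/-- The continuous extension of `f_ε'(x) / |x| ^ (γ - 1)` to `side b`. -/
def residue (F : GoodFamily) : Bool → ℝ → ℝ → ℝ
  | false => F.Rneg
  | true => F.Rpos

variable (F : GoodFamily)

lemma zero_mem : (0 : ℝ) ∈ Icc 0 F.eps0 := ⟨le_rfl, F.eps0_pos.le⟩

lemma continuousOn_residue (b : Bool) :
    ContinuousOn (fun p : ℝ × ℝ => F.residue b p.1 p.2) (Icc 0 F.eps0 ×ˢ side b) := by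
  cases b
  · exact F.Rneg_cont
  · exact F.Rpos_cont

lemma residue_ne (b : Bool) {ε : ℝ} (hε : ε ∈ Icc 0 F.eps0) {x : ℝ} (hx : x ∈ side b) :
    F.residue b ε x ≠ 0 := by
  cases b
  · exact F.Rneg_ne ε hε x hx
  · exact F.Rpos_ne ε hε x hx

lemma deriv_eq (b : Bool) {ε : ℝ} (hε : ε ∈ Icc 0 F.eps0) {x : ℝ} (hx : x ∈ side b) (hx0 : x ≠ 0) :
    F.f' ε x = F.residue b ε x * |x| ^ (F.gamma - 1) := by
  have hpos : 0 < |x| ^ (F.gamma - 1) := Real.rpow_pos_of_pos (abs_pos.2 hx0) _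
  rw [← div_eq_iff hpos.ne']
  cases b
  · exact (F.Rneg_eq ε hε x ⟨hx.1, lt_of_le_of_ne hx.2 hx0⟩).symm
  · exact (F.Rpos_eq ε hε x ⟨lt_of_le_of_ne hx.1 hx0.symm, hx.2⟩).symm

lemma abs_residue_sub_le (b : Bool) {ε : ℝ} (hε : ε ∈ Icc 0 F.eps0) {x y : ℝ} (hx : x ∈ side b)
    (hx0 : x ≠ 0) (hy : y ∈ side b) (hy0 : y ≠ 0) :
    |F.residue b ε x - F.residue b ε y| ≤ F.K'' * |x - y| ^ F.alpha'' := by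
  cases b
  · have hx' : x ∈ Ico (-1 : ℝ) 0 := ⟨hx.1, lt_of_le_of_ne hx.2 hx0⟩
    have hy' : y ∈ Ico (-1 : ℝ) 0 := ⟨hy.1, lt_of_le_of_ne hy.2 hy0⟩
    have h := F.holder''_neg ε hε x hx' y hy'
    rwa [← F.Rneg_eq ε hε x hx', ← F.Rneg_eq ε hε y hy'] at h
  · have hx' : x ∈ Ioc (0 : ℝ) 1 := ⟨lt_of_le_of_ne hx.1 hx0.symm, hx.2⟩
    have hy' : y ∈ Ioc (0 : ℝ) 1 := ⟨lt_of_le_of_ne hy.1 hy0.symm, hy.2⟩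
    have h := F.holder''_pos ε hε x hx' y hy'
    rwa [← F.Rpos_eq ε hε x hx', ← F.Rpos_eq ε hε y hy'] at h

lemma deriv_mul_sgn_nonpos (b : Bool) {ε : ℝ} (hε : ε ∈ Icc 0 F.eps0) {x : ℝ} (hx : x ∈ side b) :
    F.f' ε x * sgn b ≤ 0 := by
  have hd := (F.deriv_f ε hε x (side_subset b hx)).mono (side_subset b)
  cases b
  · have h := (F.mono ε hε).monotoneOn.derivWithin_nonneg (x := x)
    change 0 ≤ derivWithin (F.f ε) (side false) x at h
    rw [hd.derivWithin (uniqueDiffOn_Icc (by norm_num) x hx)] at h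
    simp only [sgn]
    linarith
  · have h := (F.anti ε hε).antitoneOn.derivWithin_nonpos (x := x)
    change derivWithin (F.f ε) (side true) x ≤ 0 at h
    rw [hd.derivWithin (uniqueDiffOn_Icc (by norm_num) x hx)] at h
    simp only [sgn]
    linarith

lemma neg_deriv_mul_sgn (b : Bool) {ε : ℝ} (hε : ε ∈ Icc 0 F.eps0) {t : ℝ}
    (ht : t ∈ Ioc (0 : ℝ) 1) :
    -(F.f' ε (sgn b * t) * sgn b) = |F.residue b ε (sgn b * t)| * t ^ (F.gamma - 1) := by
  have hx : sgn b * t ∈ side b := sgn_mul_mem_side ⟨ht.1.le, ht.2⟩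
  have h0 : sgn b * t ≠ 0 := abs_pos.1 (by rw [abs_sgn_mul ht.1.le]; exact ht.1)
  have hpos : 0 < t ^ (F.gamma - 1) := Real.rpow_pos_of_pos ht.1 _
  rw [← abs_of_nonpos (F.deriv_mul_sgn_nonpos b hε hx), F.deriv_eq b hε hx h0, abs_mul, abs_mul,
    abs_sgn, mul_one, abs_sgn_mul ht.1.le, abs_of_pos hpos]

lemma isUnimodal {ε : ℝ} (hε : ε ∈ Icc 0 F.eps0) : IsUnimodal ε (F.f ε) where
  eps_nonneg := hε.1
  mono := F.mono ε hε
  anti := F.anti ε hε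
  map_neg_one := F.map_neg_one ε hε
  map_one := F.map_one ε hε
  map_zero := F.map_zero ε hε
  cont x hx := (F.deriv_f ε hε x hx).continuousWithinAt

lemma exists_residue_bounds (b : Bool) : ∃ m > 0, ∃ M, ∀ ε ∈ Icc 0 F.eps0, ∀ x ∈ side b,
    m ≤ |F.residue b ε x| ∧ |F.residue b ε x| ≤ M := by
  have hc : IsCompact (Icc 0 F.eps0 ×ˢ side b) :=
    isCompact_Icc.prod (by cases b <;> exact isCompact_Icc)
  have hne : (Icc 0 F.eps0 ×ˢ side b).Nonempty := ⟨(0, 0), F.zero_mem, IsControlled.zero_mem_side b⟩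
  have hcont := (F.continuousOn_residue b).abs
  obtain ⟨p, hp, hmin⟩ := hc.exists_isMinOn hne hcont
  obtain ⟨q, -, hmax⟩ := hc.exists_isMaxOn hne hcont
  exact ⟨_, abs_pos.2 (F.residue_ne b hp.1 hp.2), _, fun ε hε x hx =>
    ⟨hmin (mk_mem_prod hε hx), hmax (mk_mem_prod hε hx)⟩⟩

lemma exists_isControlled : ∃ k : DistortionConstants, k.γ = F.gamma ∧
    ∀ ε ∈ Icc 0 F.eps0, IsControlled k ε (F.f ε) (F.f' ε) := by
  choose m hm M hmM using F.exists_residue_bounds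
  have hm0 : 0 < min (m false) (m true) := lt_min (hm _) (hm _)
  have hm_le : ∀ b, min (m false) (m true) ≤ m b := fun b => by cases b <;> simp
  have hM_le : ∀ b, M b ≤ max (M false) (M true) := fun b => by cases b <;> simp
  have hM0 : 0 < max (M false) (M true) := by
    have h := hmM false 0 F.zero_mem 0 (IsControlled.zero_mem_side _)
    exact (hm false).trans_le (h.1.trans (h.2.trans (hM_le _)))
  have hlam := F.lam_mem.1
  refine ⟨⟨F.gamma, min (m false) (m true), max (M false) (M true),
    F.K'' / min (m false) (m true), F.alpha'', (F.C0 + 2) / F.lam, F.lam, F.one_lt_gamma, hm0, hM0,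
    (div_pos F.K''_pos hm0).le, F.alpha''_mem, div_pos (by linarith [F.C0_pos]) hlam,
    F.lam_mem⟩, rfl, fun ε hε => ?_⟩
  refine ⟨F.isUnimodal hε, F.deriv_f ε hε, fun b t ht => ?_, fun b t ht => ?_,
    fun b x hx y hy hx0 hy0 => ?_, fun w => ?_⟩
  · rw [F.neg_deriv_mul_sgn b hε ht]
    have h := hmM b ε hε _ (sgn_mul_mem_side ⟨ht.1.le, ht.2⟩)
    exact mul_le_mul_of_nonneg_right ((hm_le b).trans h.1) (Real.rpow_nonneg ht.1.le _)
  · rw [F.neg_deriv_mul_sgn b hε ht]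
    have h := hmM b ε hε _ (sgn_mul_mem_side ⟨ht.1.le, ht.2⟩)
    exact mul_le_mul_of_nonneg_right (h.2.trans (hM_le b)) (Real.rpow_nonneg ht.1.le _)
  · have hlog : ∀ x ∈ side b, x ≠ 0 → Real.log (F.f' ε x) =
        Real.log |F.residue b ε x| + (F.gamma - 1) * Real.log x := by
      intro x hx hx0
      rw [F.deriv_eq b hε hx hx0, Real.log_mul (F.residue_ne b hε hx)
        (Real.rpow_pos_of_pos (abs_pos.2 hx0) _).ne', Real.log_rpow (abs_pos.2 hx0), Real.log_abs,
        Real.log_abs]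
    have h1 := abs_log_sub_log_le hm0 ((hm_le b).trans (hmM b ε hε x hx).1)
      ((hm_le b).trans (hmM b ε hε y hy).1)
    have h2 := (abs_abs_sub_abs_le_abs_sub (F.residue b ε x) (F.residue b ε y)).trans
      (F.abs_residue_sub_le b hε hx hx0 hy hy0)
    have h3 := h1.trans (div_le_div_of_nonneg_right h2 hm0.le)
    have hγ : 0 ≤ F.gamma - 1 := by linarith [F.one_lt_gamma]
    rw [hlog x hx hx0, hlog y hy hy0, add_sub_add_comm, ← mul_sub]
    refine (abs_add_le _ _).trans (add_le_add ?_ ?_)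
    · convert h3 using 1
      ring
    · rw [abs_mul, abs_of_nonneg hγ]
  · have hlen : len (Iw (F.f ε) w) ≤ 2 := by
      rw [(F.isUnimodal hε).len_Iw]
      have h1 := (F.isUnimodal hε).gw_mem w one_mem
      have h2 := (F.isUnimodal hε).gw_mem w neg_one_mem
      rw [abs_le]
      constructor <;> linarith [h1.1, h1.2, h2.1, h2.2]
    have hC0 := F.C0_pos
    have hlam1 := F.lam_mem.2
    obtain h | ⟨n, hn, hw⟩ : w.length ≤ 1 ∨ ∃ n, 1 ≤ n ∧ w.length = n + 1 := by
      by_cases h : w.length ≤ 1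
      · exact Or.inl h
      · exact Or.inr ⟨w.length - 1, by omega, by omega⟩
    · have h1 : F.lam ≤ F.lam ^ w.length := by
        simpa using pow_le_pow_of_le_one hlam.le hlam1.le h
      refine hlen.trans ?_
      rw [div_mul_eq_mul_div, le_div_iff₀ hlam]
      nlinarith
    · refine (F.decay ε hε n hn w hw).trans ?_
      rw [hw, pow_succ', ← mul_assoc, div_mul_cancel₀ _ hlam.ne']
      exact mul_le_mul_of_nonneg_right (by linarith) (pow_nonneg hlam.le _)

end GoodFamily

namespace IsControlled

variable {k : DistortionConstants} {ε : ℝ} {f f' : ℝ → ℝ}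

lemma abs_rpow_sub_le (hf : IsControlled k ε f f') {b : Bool} {x y : ℝ} (hx : x ∈ side b)
    (hy : y ∈ side b) : |(|x| ^ k.γ - |y| ^ k.γ)| ≤ k.γ / k.m * |f x - f y| := by
  have hγ := k.γ_pos
  have hm := k.m_pos
  have key : ∀ x y : ℝ, x ∈ side b → y ∈ side b → |x| ≤ |y| →
      |(|x| ^ k.γ - |y| ^ k.γ)| ≤ k.γ / k.m * |f x - f y| := by
    intro x y hx hy h
    have h1 := hf.lower_rpow hx hy h
    have h2 : |x| ^ k.γ ≤ |y| ^ k.γ := Real.rpow_le_rpow (abs_nonneg x) h hγ.le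
    rw [abs_sub_comm, abs_of_nonneg (sub_nonneg.2 h2), div_mul_eq_mul_div, le_div_iff₀ hm]
    have h3 := h1.trans (le_abs_self (f x - f y))
    rw [div_mul_eq_mul_div, div_le_iff₀ hγ] at h3
    linarith
  rcases le_total |x| |y| with h | h
  · exact key x y hx hy h
  · rw [abs_sub_comm, abs_sub_comm (f x)]
    exact key y x hy hx h

/-- Continuity of the inverse branches, jointly in the map and the point. -/
lemma tendsto_branch_of_tendsto {ι : Type*} {l : Filter ι} {g g' : ι → ℝ → ℝ} {e y : ι → ℝ}
    (b : Bool) {x : ℝ} (hx : x ∈ side b) (hg : ∀ᶠ i in l, IsControlled k (e i) (g i) (g' i))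
    (hy : ∀ᶠ i in l, y i ∈ Icc (-1 : ℝ) 1) (h : Tendsto (fun i => y i - g i x) l (𝓝 0)) :
    Tendsto (fun i => branch (g i) b (y i)) l (𝓝 x) := by
  have h1 : Tendsto (fun i => k.γ / k.m * |y i - g i x|) l (𝓝 0) := by
    simpa using h.abs.const_mul (k.γ / k.m)
  have h2 : Tendsto (fun i => |branch (g i) b (y i)| ^ k.γ) l (𝓝 (|x| ^ k.γ)) := by
    rw [tendsto_iff_dist_tendsto_zero]
    refine squeeze_zero' (Eventually.of_forall fun _ => dist_nonneg) ?_ h1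
    filter_upwards [hg, hy] with i hi hyi
    have h3 := hi.abs_rpow_sub_le (hi.branch_mem b hyi) hx
    rwa [hi.map_branch b hyi, ← Real.dist_eq] at h3
  have h4 := (h2.rpow_const (p := k.γ⁻¹) (Or.inr (inv_pos.2 k.γ_pos).le)).const_mul (sgn b)
  simp only [Real.rpow_rpow_inv (abs_nonneg _) k.γ_pos.ne', sgn_mul_abs hx] at h4
  refine h4.congr' ?_
  filter_upwards [hg, hy] with i hi hyi
  exact sgn_mul_abs (hi.branch_mem b hyi)

end IsControlled

namespace GoodFamily

variable (F : GoodFamily)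

instance neBot_nhdsWithin : (𝓝[Ioc 0 F.eps0] (0 : ℝ)).NeBot := by
  rw [nhdsWithin_Ioc_eq_nhdsGT F.eps0_pos]
  infer_instance

lemma tendsto_map {x : ℝ} (hx : x ∈ Icc (-1 : ℝ) 1) :
    Tendsto (fun ε => F.f ε x) (𝓝[Ioc 0 F.eps0] 0) (𝓝 (F.f 0 x)) := by
  have h : ContinuousWithinAt (fun ε => F.f ε x) (Icc 0 F.eps0) 0 :=
    ContinuousWithinAt.comp (g := fun p : ℝ × ℝ => F.f p.1 p.2) (f := fun ε => (ε, x))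
      (t := Icc 0 F.eps0 ×ˢ Icc (-1) 1) (F.smooth.continuousOn (0, x) ⟨F.zero_mem, hx⟩)
      (by fun_prop) fun ε hε => ⟨hε, hx⟩
  exact h.mono Ioc_subset_Icc_self

lemma tendsto_branch {k : DistortionConstants}
    (hk : ∀ ε ∈ Icc 0 F.eps0, IsControlled k ε (F.f ε) (F.f' ε)) (b : Bool) {y : ℝ → ℝ} {y₀ : ℝ}
    (hy : ∀ ε ∈ Icc 0 F.eps0, y ε ∈ Icc (-1 : ℝ) 1) (hy₀ : y₀ ∈ Icc (-1 : ℝ) 1)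
    (h : Tendsto y (𝓝[Ioc 0 F.eps0] 0) (𝓝 y₀)) :
    Tendsto (fun ε => branch (F.f ε) b (y ε)) (𝓝[Ioc 0 F.eps0] 0)
      (𝓝 (branch (F.f 0) b y₀)) := by
  have h0 := hk 0 F.zero_mem
  have hx := h0.branch_mem b hy₀
  have hev : ∀ᶠ ε in 𝓝[Ioc 0 F.eps0] (0 : ℝ), ε ∈ Icc 0 F.eps0 :=
    (eventually_mem_nhdsWithin).mono fun ε hε => Ioc_subset_Icc_self hε
  refine IsControlled.tendsto_branch_of_tendsto b hx (hev.mono hk) (hev.mono hy) ?_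
  have h2 := h.sub (F.tendsto_map (side_subset b hx))
  rwa [h0.map_branch b hy₀, sub_self] at h2

lemma tendsto_gw {k : DistortionConstants}
    (hk : ∀ ε ∈ Icc 0 F.eps0, IsControlled k ε (F.f ε) (F.f' ε)) (w : List Bool) {y : ℝ → ℝ}
    {y₀ : ℝ} (hy : ∀ ε ∈ Icc 0 F.eps0, y ε ∈ Icc (-1 : ℝ) 1) (hy₀ : y₀ ∈ Icc (-1 : ℝ) 1)
    (h : Tendsto y (𝓝[Ioc 0 F.eps0] 0) (𝓝 y₀)) :
    Tendsto (fun ε => gw (F.f ε) w (y ε)) (𝓝[Ioc 0 F.eps0] 0) (𝓝 (gw (F.f 0) w y₀)) := by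
  induction w with
  | nil => exact h
  | cons b w ih =>
    exact F.tendsto_branch hk b (fun ε hε => (hk ε hε).gw_mem w (hy ε hε))
      ((hk 0 F.zero_mem).gw_mem w hy₀) ih

lemma tendsto_ratio {k : DistortionConstants}
    (hk : ∀ ε ∈ Icc 0 F.eps0, IsControlled k ε (F.f ε) (F.f' ε)) (a : ℕ → Bool) (n : ℕ) :
    Tendsto (fun ε => ratio (F.f ε) a n) (𝓝[Ioc 0 F.eps0] 0) (𝓝 (ratio (F.f 0) a n)) := by
  have h0 := hk 0 F.zero_mem
  have hlen : ∀ w, Tendsto (fun ε => len (Iw (F.f ε) w)) (𝓝[Ioc 0 F.eps0] 0)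
      (𝓝 (len (Iw (F.f 0) w))) := by
    intro w
    rw [h0.len_Iw]
    refine Tendsto.congr' ?_ (((F.tendsto_gw hk w (fun _ _ => one_mem) one_mem
      tendsto_const_nhds).sub (F.tendsto_gw hk w (fun _ _ => neg_one_mem) neg_one_mem
      tendsto_const_nhds)).abs)
    filter_upwards [eventually_mem_nhdsWithin] with ε hε
    rw [(hk ε (Ioc_subset_Icc_self hε)).len_Iw]
  exact (hlen _).div (hlen _) (h0.len_pos _).ne'

/-- Bounds at the last coordinate equal to `1` pass to the limit scaling function. -/
lemma limit_scaling_le_of_true {k : DistortionConstants}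
    (hk : ∀ ε ∈ Icc 0 F.eps0, IsControlled k ε (F.f ε) (F.f' ε)) {s : ℝ → (ℕ → Bool) → ℝ}
    (hs : ∀ ε ∈ Ioc 0 F.eps0, IsScalingFun (F.f ε) (s ε)) {a : ℕ → Bool} {s₀ : ℝ}
    (hs₀ : Tendsto (fun ε => s ε a) (𝓝[Ioc 0 F.eps0] 0) (𝓝 s₀)) {m : ℕ} (hm : 1 ≤ m)
    (ham : a m = true) :
    s₀ ≤ Real.exp (k.distConst * k.θ ^ m) * ratio (F.f 0) a (m + 1) ∧
      ratio (F.f 0) a (m + 1) ≤ Real.exp (k.distConst * k.θ ^ m) * s₀ := by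
  have h := F.tendsto_ratio hk a (m + 1)
  have hev : ∀ᶠ ε in 𝓝[Ioc 0 F.eps0] (0 : ℝ), ε ∈ Ioc 0 F.eps0 := eventually_mem_nhdsWithin
  constructor
  · exact le_of_tendsto_of_tendsto hs₀ (h.const_mul _) (hev.mono fun ε hε =>
      ((hk ε (Ioc_subset_Icc_self hε)).scaling_le_of_true (hs ε hε) hm ham).1)
  · exact le_of_tendsto_of_tendsto h (hs₀.const_mul _) (hev.mono fun ε hε =>
      ((hk ε (Ioc_subset_Icc_self hε)).scaling_le_of_true (hs ε hε) hm ham).2)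

lemma limit_scaling_le_of_false {k : DistortionConstants}
    (hk : ∀ ε ∈ Icc 0 F.eps0, IsControlled k ε (F.f ε) (F.f' ε)) {s : ℝ → (ℕ → Bool) → ℝ}
    (hs : ∀ ε ∈ Ioc 0 F.eps0, IsScalingFun (F.f ε) (s ε)) {a : ℕ → Bool} {s₀ : ℝ}
    (hs₀ : Tendsto (fun ε => s ε a) (𝓝[Ioc 0 F.eps0] 0) (𝓝 s₀)) {m : ℕ}
    (ha : ∀ i > m, a i = false) :
    s₀ ≤ Real.exp (k.stepConst / (1 - k.θ) * k.θ ^ m) * ratio (F.f 0) a (m + 1) ∧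
      ratio (F.f 0) a (m + 1) ≤ Real.exp (k.stepConst / (1 - k.θ) * k.θ ^ m) * s₀ := by
  have h := F.tendsto_ratio hk a (m + 1)
  have hev : ∀ᶠ ε in 𝓝[Ioc 0 F.eps0] (0 : ℝ), ε ∈ Ioc 0 F.eps0 := eventually_mem_nhdsWithin
  constructor
  · exact le_of_tendsto_of_tendsto hs₀ (h.const_mul _) (hev.mono fun ε hε =>
      ((hk ε (Ioc_subset_Icc_self hε)).scaling_le_of_false (hs ε hε) ha).1)
  · exact le_of_tendsto_of_tendsto h (hs₀.const_mul _) (hev.mono fun ε hε =>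
      ((hk ε (Ioc_subset_Icc_self hε)).scaling_le_of_false (hs ε hε) ha).2)

end GoodFamily

namespace IsControlled

variable {k : DistortionConstants} {ε : ℝ} {f f' : ℝ → ℝ}

lemma leadingZeros_replicate (n : ℕ) : leadingZeros (List.replicate n false) = n := by
  induction n with
  | zero => rfl
  | succ n ih => rw [List.replicate_succ, leadingZeros, ih]

lemma deriv_neg_one_pos (hf : IsControlled k ε f f') : 0 < f' (-1) := by
  have h := hf.lower false 1 ⟨one_pos, le_rfl⟩
  norm_num [sgn] at h
  exact k.m_pos.trans_le h

lemma gw_replicate_mem (hf : IsControlled k ε f f') (n : ℕ) {x : ℝ} (hx : x ∈ Icc (-1 : ℝ) 0) :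
    gw f (List.replicate n false) x ∈ Icc (-1 : ℝ) 0 := by
  cases n with
  | zero => exact hx
  | succ n => exact hf.branch_mem false (hf.gw_mem _ (side_subset false hx))

lemma gw_replicate_lt (hf : IsControlled k ε f f') (n : ℕ) {p q : ℝ} (hp : p ∈ Icc (-1 : ℝ) 1)
    (hq : q ∈ Icc (-1 : ℝ) 1) (h : q < p) :
    gw f (List.replicate n false) q < gw f (List.replicate n false) p := by
  induction n with
  | zero => exact h
  | succ n ih => exact hf.strictMonoOn_branch_false (hf.gw_mem _ hq) (hf.gw_mem _ hp) ih

/-- Rescaled distances between the preimages under the branch fixing `-1` converge. -/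
lemma exists_tendsto_rescaled_sub (hf : IsControlled k ε f f') {p q : ℝ}
    (hp : p ∈ Icc (-1 : ℝ) 0) (hq : q ∈ Icc (-1 : ℝ) 0) (h : q < p) :
    ∃ l > 0, Tendsto (fun n : ℕ => f' (-1) ^ n *
      (gw f (List.replicate n false) p - gw f (List.replicate n false) q)) atTop (𝓝 l) := by
  have hκ := hf.deriv_neg_one_pos
  have hp1 := side_subset false hp
  have hq1 := side_subset false hq
  have hd : ∀ n, 0 < gw f (List.replicate n false) p - gw f (List.replicate n false) q :=
    fun n => sub_pos.2 (hf.gw_replicate_lt n hp1 hq1 h)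
  set u : ℕ → ℝ := fun n => Real.log (f' (-1) ^ n *
      (gw f (List.replicate n false) p - gw f (List.replicate n false) q)) with hu
  have hu_eq : ∀ n, u n = n * Real.log (f' (-1)) +
      Real.log (gw f (List.replicate n false) p - gw f (List.replicate n false) q) := by
    intro n
    rw [hu]
    simp only
    rw [Real.log_mul (pow_pos hκ n).ne' (hd n).ne', Real.log_pow]
  have hstep : ∀ n, dist (u n) (u (n + 1)) ≤ k.fixConst * k.θ ^ n := by
    intro n
    obtain ⟨z, hz, hz0, hzeq⟩ := hf.exists_abs_sub_eq false (hf.gw_mem (List.replicate n false) hp1)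
      (hf.gw_mem (List.replicate n false) hq1) (sub_pos.1 (hd n)).ne'
    have hz' : z ∈ Icc (-1 : ℝ) 0 :=
      uIcc_subset_Icc (hf.gw_replicate_mem n hp) (hf.gw_replicate_mem n hq) hz
    have hzI : z ∈ Iw f (List.replicate n false) := by
      have e1 := gw_mem_Iw f (List.replicate n false) hp1
      have e2 := gw_mem_Iw f (List.replicate n false) hq1
      rw [hf.Iw_eq] at e1 e2 ⊢
      exact uIcc_subset_uIcc e1 e2 hz
    obtain ⟨x, hx, rfl⟩ := hzI
    have h1 := hf.one_add_gw_le (List.replicate n false) hx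
    have h2 := hf.one_add_gw_le (List.replicate (n + 1) false) hx
    rw [leadingZeros_replicate] at h1 h2
    rw [List.replicate_succ, gw_cons] at h2
    have hdist := hf.log_deriv_sub_le_of_nonpos false hz' (left_mem_Icc.2 (by norm_num))
    have hbr := hf.branch_mem false (hf.gw_mem (List.replicate n false) hx)
    have e1 : 0 ≤ 1 + branch f false (gw f (List.replicate n false) x) := by linarith [hbr.1]
    have e2 : 0 ≤ 1 + gw f (List.replicate n false) x := by linarith [hz'.1]
    rw [hf.branch_false_neg_one, sub_neg_eq_add, sub_neg_eq_add, add_comm _ (1 : ℝ),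
      add_comm _ (1 : ℝ), abs_of_nonneg e1, abs_of_nonneg e2] at hdist
    have hlog : Real.log (gw f (List.replicate n false) p - gw f (List.replicate n false) q) =
        Real.log (f' (branch f false (gw f (List.replicate n false) x))) +
        Real.log (gw f (List.replicate (n + 1) false) p -
          gw f (List.replicate (n + 1) false) q) := by
      have hne := (hd (n + 1)).ne'
      rw [List.replicate_succ, gw_cons, gw_cons] at hne ⊢
      rw [← Real.log_abs, hzeq, Real.log_mul (hf.abs_deriv_pos hbr hz0).ne' (abs_pos.2 hne).ne',
        Real.log_abs, Real.log_abs]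
    have hC : k.C * k.lam ^ (n + 1) ≤ k.C * k.lam ^ n :=
      mul_le_mul_of_nonneg_left (pow_le_pow_of_le_one k.lam_mem.1.le k.lam_mem.2.le n.le_succ)
        k.C_pos.le
    have h3 := k.rpow_le_of_le_decay e1 (h2.trans hC)
    have h4 : 1 + gw f (List.replicate n false) x ≤ k.C * k.θ ^ n :=
      h1.trans (mul_le_mul_of_nonneg_left (k.lam_pow_le n) k.C_pos.le)
    have h5 := mul_le_mul_of_nonneg_left h3 k.H_nonneg
    have h6 := mul_le_mul_of_nonneg_left h4 k.critFactor_nonneg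
    rw [Real.dist_eq, hu_eq, hu_eq, hlog, DistortionConstants.fixConst]
    refine le_trans (le_of_eq ?_) (hdist.trans ((add_le_add h5 h6).trans (le_of_eq ?_)))
    · push_cast
      congr 1
      ring
    · ring
  obtain ⟨l, hl⟩ := cauchySeq_tendsto_of_complete
    (cauchySeq_of_le_geometric k.θ k.fixConst k.θ_lt_one hstep)
  refine ⟨Real.exp l, Real.exp_pos l, ((Real.continuous_exp.tendsto l).comp hl).congr fun n => ?_⟩
  exact Real.exp_log (mul_pos (pow_pos hκ n) (hd n))

/-- The linearization of the branch fixing `-1`. -/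
lemma exists_linearization (hf : IsControlled k ε f f') : ∃ φ : ℝ → ℝ,
    StrictMonoOn φ (Icc (-1) 0) ∧ φ (-1) = 0 ∧ ∀ t ∈ Icc (-1 : ℝ) 0,
      Tendsto (fun n : ℕ => f' (-1) ^ n * (1 + gw f (List.replicate n false) t)) atTop
        (𝓝 (φ t)) := by
  have hm : (-1 : ℝ) ∈ Icc (-1 : ℝ) 0 := left_mem_Icc.2 (by norm_num)
  have hex : ∀ t ∈ Icc (-1 : ℝ) 0, ∃ l, Tendsto (fun n : ℕ =>
      f' (-1) ^ n * (1 + gw f (List.replicate n false) t)) atTop (𝓝 l) := by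
    intro t ht
    rcases ht.1.eq_or_lt with rfl | hlt
    · exact ⟨0, by simp [hf.gw_replicate_neg_one]⟩
    · obtain ⟨l, -, hl⟩ := hf.exists_tendsto_rescaled_sub ht hm hlt
      refine ⟨l, hl.congr fun n => ?_⟩
      rw [hf.gw_replicate_neg_one, sub_neg_eq_add, add_comm]
  choose! φ hφ using hex
  refine ⟨φ, fun q hq p hp h => ?_, ?_, hφ⟩
  · obtain ⟨l, hl0, hl⟩ := hf.exists_tendsto_rescaled_sub hp hq h
    have := tendsto_nhds_unique (((hφ p hp).sub (hφ q hq)).congr fun n => by ring) hl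
    linarith
  · refine tendsto_nhds_unique (hφ (-1) hm) ?_
    simp [hf.gw_replicate_neg_one]

end IsControlled

namespace IsControlled

variable {k : DistortionConstants} {f f' : ℝ → ℝ}

lemma tendsto_sub_div_rpow {ε : ℝ} (hf : IsControlled k ε f f') (b : Bool) {ρ : ℝ}
    (hρ : Tendsto (fun t => -(f' (sgn b * t) * sgn b) / t ^ (k.γ - 1)) (𝓝[>] 0) (𝓝 ρ)) :
    Tendsto (fun t => (f 0 - f (sgn b * t)) / t ^ k.γ) (𝓝[>] 0) (𝓝 (ρ / k.γ)) := by
  have hγ := k.γ_pos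
  have hmem : ∀ᶠ t in 𝓝[>] (0 : ℝ), t ∈ Ioo (0 : ℝ) 1 := Ioo_mem_nhdsGT one_pos
  refine HasDerivAt.lhopital_zero_nhdsGT (f' := fun t => -(f' (sgn b * t) * sgn b))
    (g' := fun t => k.γ * t ^ (k.γ - 1)) ?_ ?_ ?_ ?_ ?_ ?_
  · filter_upwards [hmem] with t ht
    exact (hf.deriv_sgn_mul b ht).const_sub (f 0)
  · filter_upwards [hmem] with t ht
    exact Real.hasDerivAt_rpow_const (Or.inl ht.1.ne')
  · filter_upwards [hmem] with t ht
    exact (mul_pos hγ (Real.rpow_pos_of_pos ht.1 _)).ne'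
  · have h := (hf.continuousOn_sgn_mul b 0 (left_mem_Icc.2 zero_le_one)).tendsto
    rw [mul_zero] at h
    have h2 := (h.mono_left (nhdsWithin_mono 0 Ioo_subset_Icc_self)).const_sub (f 0)
    rwa [sub_self, nhdsWithin_Ioo_eq_nhdsGT one_pos] at h2
  · have h := (Real.continuousAt_rpow_const 0 k.γ (Or.inr hγ.le)).tendsto
    rw [Real.zero_rpow hγ.ne'] at h
    exact h.mono_left nhdsWithin_le_nhds
  · refine (hρ.div_const k.γ).congr fun t => ?_
    rw [div_div, mul_comm k.γ]

/-- Near the critical value, the inverse branches behave like a power. -/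
lemma exists_tendsto_branch_div_rpow (hf : IsControlled k 0 f f') (b : Bool) {ρ : ℝ} (hρ0 : 0 < ρ)
    (hρ : Tendsto (fun t => -(f' (sgn b * t) * sgn b) / t ^ (k.γ - 1)) (𝓝[>] 0) (𝓝 ρ)) :
    ∃ c > 0, Tendsto (fun t => |branch f b (1 - t)| / t ^ k.γ⁻¹) (𝓝[>] 0) (𝓝 c) := by
  have hγ := k.γ_pos
  have hmap0 : f 0 = 1 := by rw [hf.map_zero, add_zero]
  have hmem : ∀ᶠ t in 𝓝[>] (0 : ℝ), t ∈ Ioo (0 : ℝ) 1 := Ioo_mem_nhdsGT one_pos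
  have hmem1 : ∀ t ∈ Ioo (0 : ℝ) 1, 1 - t ∈ Icc (-1 : ℝ) 1 := fun t ht =>
    ⟨by linarith [ht.2], by linarith [ht.1]⟩
  have hz : Tendsto (fun t => |branch f b (1 - t)|) (𝓝[>] 0) (𝓝[>] 0) := by
    refine tendsto_nhdsWithin_iff.2 ⟨?_, hmem.mono fun t ht => mem_Ioi.2 (abs_pos.2 fun h => ?_)⟩
    · have h := tendsto_branch_of_tendsto (k := k) (l := 𝓝[>] (0 : ℝ)) (g := fun _ => f)
        (g' := fun _ => f') (e := fun _ => 0) (y := fun t => 1 - t) b (zero_mem_side b)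
        (Eventually.of_forall fun _ => hf) (hmem.mono hmem1) (by
          have : Tendsto (fun t : ℝ => 1 - t - f 0) (𝓝 0) (𝓝 (1 - 0 - f 0)) :=
            Continuous.tendsto (by fun_prop) 0
          rw [hmap0] at this ⊢
          simpa using this.mono_left nhdsWithin_le_nhds)
      simpa using h.abs
    · have h1 := hf.map_branch b (hmem1 t ht)
      rw [h, hmap0] at h1
      linarith [ht.1]
  have h1 := ((hf.tendsto_sub_div_rpow b hρ).comp hz).inv₀ (div_pos hρ0 hγ).ne'
  have h2 := h1.rpow_const (p := k.γ⁻¹) (Or.inr (inv_pos.2 hγ).le)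
  refine ⟨_, Real.rpow_pos_of_pos (inv_pos.2 (div_pos hρ0 hγ)) _, h2.congr' ?_⟩
  filter_upwards [hmem] with t ht
  rw [Function.comp_apply, sgn_mul_abs (hf.branch_mem b (hmem1 t ht)),
    hf.map_branch b (hmem1 t ht), hmap0, sub_sub_cancel, inv_div,
    Real.div_rpow (Real.rpow_nonneg (abs_nonneg _) _) ht.1.le,
    Real.rpow_rpow_inv (abs_nonneg _) hγ.ne']

lemma exists_tendsto_one_sub_branch_div {ε : ℝ} (hf : IsControlled k ε f f') :
    ∃ c > 0, Tendsto (fun t => (1 - branch f true (t - 1)) / t) (𝓝[>] 0) (𝓝 c) := by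
  have hmem : ∀ᶠ t in 𝓝[>] (0 : ℝ), t ∈ Ioo (0 : ℝ) 1 := Ioo_mem_nhdsGT one_pos
  have hmem1 : ∀ t ∈ Ioo (0 : ℝ) 1, t - 1 ∈ Icc (-1 : ℝ) 1 := fun t ht =>
    ⟨by linarith [ht.1], by linarith [ht.2]⟩
  have hneg : f' 1 < 0 := by
    have h := hf.lower true 1 ⟨one_pos, le_rfl⟩
    norm_num [sgn] at h
    linarith [k.m_pos]
  have hv : Tendsto (fun t => branch f true (t - 1)) (𝓝[>] 0) (𝓝[Icc (-1) 1 \ {1}] 1) := by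
    refine tendsto_nhdsWithin_iff.2 ⟨?_, hmem.mono fun t ht =>
      ⟨hf.branch_mem_Icc true (hmem1 t ht), fun h => ?_⟩⟩
    · refine tendsto_branch_of_tendsto (k := k) (l := 𝓝[>] (0 : ℝ)) (g := fun _ => f)
        (g' := fun _ => f') (e := fun _ => ε) (y := fun t => t - 1) true
        (right_mem_Icc.2 zero_le_one) (Eventually.of_forall fun _ => hf) (hmem.mono hmem1) ?_
      have : Tendsto (fun t : ℝ => t - 1 - f 1) (𝓝 0) (𝓝 (0 - 1 - f 1)) :=
        Continuous.tendsto (by fun_prop) 0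
      rw [hf.map_one] at this ⊢
      simpa using this.mono_left nhdsWithin_le_nhds
    · have h1 := hf.map_branch true (hmem1 t ht)
      rw [mem_singleton_iff.1 h, hf.map_one] at h1
      linarith [ht.1]
  have h1 := (hasDerivWithinAt_iff_tendsto_slope.1 (hf.deriv 1 one_mem)).comp hv
  refine ⟨_, neg_pos.2 (inv_lt_zero.2 hneg), (h1.inv₀ hneg.ne).neg.congr' ?_⟩
  filter_upwards [hmem] with t ht
  rw [Function.comp_apply, slope_def_field, hf.map_branch true (hmem1 t ht), hf.map_one, inv_div,
    sub_neg_eq_add, sub_add_cancel, ← neg_div, neg_sub]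

/-- Passing the fold, the branches behave like a power near the fixed point `-1`. -/
lemma exists_tendsto_fold_div_rpow (hf : IsControlled k 0 f f') (b : Bool) {ρ : ℝ} (hρ0 : 0 < ρ)
    (hρ : Tendsto (fun t => -(f' (sgn b * t) * sgn b) / t ^ (k.γ - 1)) (𝓝[>] 0) (𝓝 ρ)) :
    ∃ c > 0, Tendsto (fun t => |branch f b (branch f true (t - 1))| / t ^ k.γ⁻¹) (𝓝[>] 0)
      (𝓝 c) := by
  obtain ⟨c₁, hc₁, h₁⟩ := hf.exists_tendsto_branch_div_rpow b hρ0 hρ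
  obtain ⟨c₂, hc₂, h₂⟩ := hf.exists_tendsto_one_sub_branch_div
  have hpos : ∀ᶠ t in 𝓝[>] (0 : ℝ), 0 < (1 - branch f true (t - 1)) / t :=
    h₂.eventually_const_lt hc₂
  have hu : Tendsto (fun t => 1 - branch f true (t - 1)) (𝓝[>] 0) (𝓝[>] 0) := by
    refine tendsto_nhdsWithin_iff.2 ⟨?_, ?_⟩
    · have h := h₂.mul (tendsto_id.mono_left (nhdsWithin_le_nhds (a := (0 : ℝ)) (s := Ioi 0)))
      rw [mul_zero] at h
      refine h.congr' ?_
      filter_upwards [self_mem_nhdsWithin] with t ht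
      exact div_mul_cancel₀ _ (ne_of_gt ht)
    · filter_upwards [hpos, self_mem_nhdsWithin] with t h ht
      exact (div_pos_iff_of_pos_right ht).1 h
  refine ⟨_, mul_pos hc₁ (Real.rpow_pos_of_pos hc₂ k.γ⁻¹),
    ((h₁.comp hu).mul (h₂.rpow_const (Or.inl hc₂.ne'))).congr' ?_⟩
  filter_upwards [hpos, self_mem_nhdsWithin] with t h ht
  have hu0 := (div_pos_iff_of_pos_right ht).1 h
  rw [Function.comp_apply, sub_sub_cancel, Real.div_rpow hu0.le (le_of_lt ht)]
  exact div_mul_div_cancel₀ (Real.rpow_pos_of_pos hu0 _).ne'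

end IsControlled

namespace GoodFamily

variable (F : GoodFamily)

lemma exists_tendsto_residue (b : Bool) : ∃ ρ > 0, Tendsto (fun t =>
    -(F.f' 0 (sgn b * t) * sgn b) / t ^ (F.gamma - 1)) (𝓝[>] 0) (𝓝 ρ) := by
  refine ⟨_, abs_pos.2 (F.residue_ne b F.zero_mem (IsControlled.zero_mem_side b)), ?_⟩
  have hmem : Tendsto (fun t => ((0 : ℝ), sgn b * t)) (𝓝[>] 0)
      (𝓝[Icc 0 F.eps0 ×ˢ side b] (0, 0)) := by
    refine tendsto_nhdsWithin_iff.2 ⟨?_, ?_⟩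
    · have h : Tendsto (fun t => ((0 : ℝ), sgn b * t)) (𝓝 0) (𝓝 (0, sgn b * 0)) :=
        Continuous.tendsto (by fun_prop) 0
      rw [mul_zero] at h
      exact h.mono_left nhdsWithin_le_nhds
    · filter_upwards [Ioo_mem_nhdsGT one_pos] with t ht
      exact ⟨F.zero_mem, sgn_mul_mem_side (Ioo_subset_Icc_self ht)⟩
  refine (((F.continuousOn_residue b (0, 0) ⟨F.zero_mem,
    IsControlled.zero_mem_side b⟩).tendsto.comp hmem).abs).congr' ?_
  filter_upwards [Ioo_mem_nhdsGT one_pos] with t ht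
  rw [F.neg_deriv_mul_sgn b F.zero_mem (Ioo_subset_Ioc_self ht),
    mul_div_cancel_right₀ _ (Real.rpow_pos_of_pos ht.1 _).ne']
  rfl

end GoodFamily

lemma rpow_chord_lt {p : ℝ} (hp0 : 0 < p) (hp1 : p < 1) {u c v : ℝ} (hu : 0 ≤ u) (huc : u < c)
    (hcv : c < v) :
    (c - u) / (v - u) < (c ^ p - u ^ p) / (v ^ p - u ^ p) := by
  have h := (Real.strictConcaveOn_rpow hp0 hp1).slope_anti_adjacent (x := u) (y := c) (z := v)
    hu (hu.trans (huc.le.trans hcv.le)) huc hcv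
  rw [div_lt_div_iff₀ (sub_pos.2 hcv) (sub_pos.2 huc)] at h
  have h1 : u ^ p < v ^ p := Real.rpow_lt_rpow hu (huc.trans hcv) hp0
  rw [div_lt_div_iff₀ (sub_pos.2 (huc.trans hcv)) (sub_pos.2 h1)]
  linarith

lemma abs_rpow_sub_div_ne {p : ℝ} (hp0 : 0 < p) (hp1 : p < 1) {x y c a : ℝ} (hx : 0 ≤ x)
    (hy : 0 ≤ y) (hc : c ∈ uIcc x y) (hcx : c ≠ x) (hcy : c ≠ y) (ha : a = x ∨ a = y) :
    |c ^ p - a ^ p| / |x ^ p - y ^ p| ≠ |c - a| / |x - y| := by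
  wlog hxy : x ≤ y generalizing x y
  · rw [abs_sub_comm (x ^ p), abs_sub_comm x]
    exact this hy hx (by rwa [uIcc_comm]) hcy hcx ha.symm (le_of_not_ge hxy)
  rw [uIcc_of_le hxy] at hc
  have hxc : x < c := lt_of_le_of_ne hc.1 hcx.symm
  have hcy' : c < y := lt_of_le_of_ne hc.2 hcy
  have h := rpow_chord_lt hp0 hp1 hx hxc hcy'
  have h1 : x ^ p < c ^ p := Real.rpow_lt_rpow hx hxc hp0
  have h2 : c ^ p < y ^ p := Real.rpow_lt_rpow (hx.trans hxc.le) hcy' hp0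
  rw [abs_sub_comm (x ^ p), abs_sub_comm x, abs_of_pos (sub_pos.2 (h1.trans h2)),
    abs_of_pos (sub_pos.2 (hxc.trans hcy'))]
  rcases ha with rfl | rfl
  · rw [abs_of_pos (sub_pos.2 h1), abs_of_pos (sub_pos.2 hxc)]
    exact h.ne'
  · rw [abs_sub_comm (c ^ p), abs_sub_comm c, abs_of_pos (sub_pos.2 h2),
      abs_of_pos (sub_pos.2 hcy')]
    have e1 := (add_div (c - x) (a - c) (a - x)).symm
    have e2 := (add_div (c ^ p - x ^ p) (a ^ p - c ^ p) (a ^ p - x ^ p)).symm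
    rw [sub_add_sub_cancel', div_self (sub_pos.2 (hxc.trans hcy')).ne'] at e1
    rw [sub_add_sub_cancel', div_self (sub_pos.2 (h1.trans h2)).ne'] at e2
    intro heq
    linarith

lemma lenRatio_append (f : ℝ → ℝ) (u v : List Bool) (p q r s : ℝ) :
    lenRatio f (u ++ v) p q r s = lenRatio f u (gw f v p) (gw f v q) (gw f v r) (gw f v s) := by
  simp only [lenRatio, gw_append]

lemma innerWord_add_of_false {a : ℕ → Bool} {N : ℕ} (ha : ∀ n > N, a n = false) (n : ℕ) :
    innerWord a (N + n) = List.replicate n false ++ innerWord a N := by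
  induction n with
  | zero => rfl
  | succ n ih =>
    rw [← add_assoc, innerWord, ih, ha _ (by omega), List.replicate_succ, List.cons_append]

namespace IsControlled

variable {k : DistortionConstants} {f f' : ℝ → ℝ}

lemma branch_one (hf : IsControlled k 0 f f') (b : Bool) : branch f b 1 = 0 := by
  have h := hf.branch_map (zero_mem_side b)
  rw [hf.map_zero, add_zero] at h
  exact h one_mem

/-- The asymptotic shape of the left preimages of points of `[-1, 0]`. -/
lemma tendsto_lenRatio_replicate {ε : ℝ} (hf : IsControlled k ε f f') {φ : ℝ → ℝ}
    (hmono : StrictMonoOn φ (Icc (-1) 0))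
    (hφ : ∀ t ∈ Icc (-1 : ℝ) 0, Tendsto (fun n : ℕ =>
      f' (-1) ^ n * (1 + gw f (List.replicate n false) t)) atTop (𝓝 (φ t)))
    {p q r s : ℝ} (hp : p ∈ Icc (-1 : ℝ) 0) (hq : q ∈ Icc (-1 : ℝ) 0)
    (hr : r ∈ Icc (-1 : ℝ) 0) (hs : s ∈ Icc (-1 : ℝ) 0) (hrs : r ≠ s) :
    Tendsto (fun n : ℕ => lenRatio f (List.replicate n false) p q r s) atTop
      (𝓝 (|φ p - φ q| / |φ r - φ s|)) := by
  have hne : |φ r - φ s| ≠ 0 :=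
    (abs_pos.2 (sub_ne_zero.2 fun h => hrs (hmono.injOn hr hs h))).ne'
  refine ((((hφ p hp).sub (hφ q hq)).abs).div (((hφ r hr).sub (hφ s hs)).abs) hne).congr
    fun n => ?_
  rw [Pi.div_apply, ← mul_sub, ← mul_sub, abs_mul, abs_mul, add_sub_add_left_eq_sub,
    add_sub_add_left_eq_sub,
    mul_div_mul_left _ _ (abs_pos.2 (pow_pos hf.deriv_neg_one_pos n).ne').ne', lenRatio]

lemma exists_tendsto_rescaled_fold (hf : IsControlled k 0 f f') (b : Bool) {ρ : ℝ} (hρ0 : 0 < ρ)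
    (hρ : Tendsto (fun t => -(f' (sgn b * t) * sgn b) / t ^ (k.γ - 1)) (𝓝[>] 0) (𝓝 ρ))
    {φ : ℝ → ℝ} (hφ0 : φ (-1) = 0)
    (hφ : ∀ t ∈ Icc (-1 : ℝ) 0, Tendsto (fun n : ℕ =>
      f' (-1) ^ n * (1 + gw f (List.replicate n false) t)) atTop (𝓝 (φ t))) :
    ∃ c > 0, ∀ x ∈ Icc (-1 : ℝ) 0, Tendsto (fun n : ℕ => (f' (-1) ^ n) ^ k.γ⁻¹ *
      |gw f (b :: true :: List.replicate n false) x|) atTop (𝓝 (c * φ x ^ k.γ⁻¹)) := by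
  have hp := inv_pos.2 k.γ_pos
  obtain ⟨c, hc, h⟩ := hf.exists_tendsto_fold_div_rpow b hρ0 hρ
  refine ⟨c, hc, fun x hx => ?_⟩
  rcases hx.1.eq_or_lt with rfl | hlt
  · have h0 : ∀ n, gw f (b :: true :: List.replicate n false) (-1) = 0 := fun n => by
      rw [gw_cons, gw_cons, hf.gw_replicate_neg_one, hf.branch_true_neg_one, hf.branch_one]
    simp [h0, hφ0, Real.zero_rpow hp.ne']
  · have hx1 := side_subset false hx
    have hpos : ∀ n, 0 < 1 + gw f (List.replicate n false) x := fun n => by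
      have := hf.gw_replicate_lt n hx1 neg_one_mem hlt
      rw [hf.gw_replicate_neg_one] at this
      linarith
    have ht : Tendsto (fun n : ℕ => 1 + gw f (List.replicate n false) x) atTop (𝓝[>] 0) := by
      refine tendsto_nhdsWithin_iff.2 ⟨?_, Eventually.of_forall hpos⟩
      refine squeeze_zero (fun n => (hpos n).le) (fun n => ?_)
        (by simpa using (tendsto_pow_atTop_nhds_zero_of_lt_one k.lam_mem.1.le
          k.lam_mem.2).const_mul k.C)
      have := hf.one_add_gw_le (List.replicate n false) hx1
      rwa [leadingZeros_replicate] at this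
    refine ((h.comp ht).mul ((hφ x hx).rpow_const (Or.inr hp.le))).congr fun n => ?_
    have hne := (Real.rpow_pos_of_pos (hpos n) k.γ⁻¹).ne'
    rw [Function.comp_apply, Real.mul_rpow (pow_pos hf.deriv_neg_one_pos n).le (hpos n).le,
      add_sub_cancel_left, gw_cons, gw_cons,
      mul_left_comm, div_mul_cancel₀ _ hne]

/-- The asymptotic shape after the fold of the left preimages of points of `[-1, 0]`. -/
lemma tendsto_lenRatio_fold (hf : IsControlled k 0 f f') (b : Bool) {ρ : ℝ} (hρ0 : 0 < ρ)
    (hρ : Tendsto (fun t => -(f' (sgn b * t) * sgn b) / t ^ (k.γ - 1)) (𝓝[>] 0) (𝓝 ρ))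
    {φ : ℝ → ℝ} (hmono : StrictMonoOn φ (Icc (-1) 0)) (hφ0 : φ (-1) = 0)
    (hφ : ∀ t ∈ Icc (-1 : ℝ) 0, Tendsto (fun n : ℕ =>
      f' (-1) ^ n * (1 + gw f (List.replicate n false) t)) atTop (𝓝 (φ t)))
    {p q r s : ℝ} (hp : p ∈ Icc (-1 : ℝ) 0) (hq : q ∈ Icc (-1 : ℝ) 0)
    (hr : r ∈ Icc (-1 : ℝ) 0) (hs : s ∈ Icc (-1 : ℝ) 0) (hrs : r ≠ s) :
    Tendsto (fun n : ℕ => lenRatio f (b :: true :: List.replicate n false) p q r s) atTop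
      (𝓝 (|φ p ^ k.γ⁻¹ - φ q ^ k.γ⁻¹| / |φ r ^ k.γ⁻¹ - φ s ^ k.γ⁻¹|)) := by
  obtain ⟨c, hc, h⟩ := hf.exists_tendsto_rescaled_fold b hρ0 hρ hφ0 hφ
  have hnn : ∀ t ∈ Icc (-1 : ℝ) 0, 0 ≤ φ t := fun t ht =>
    hφ0 ▸ hmono.monotoneOn (left_mem_Icc.2 (by norm_num)) ht ht.1
  have hne : c * φ r ^ k.γ⁻¹ - c * φ s ^ k.γ⁻¹ ≠ 0 := by
    rw [← mul_sub]
    refine mul_ne_zero hc.ne' (sub_ne_zero.2 fun h => hrs (hmono.injOn hr hs ?_))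
    exact (Real.rpow_left_inj (hnn r hr) (hnn s hs) (inv_pos.2 k.γ_pos).ne').1 h
  have hlim := (((h p hp).sub (h q hq)).abs).div (((h r hr).sub (h s hs)).abs) (abs_pos.2 hne).ne'
  rw [← mul_sub, ← mul_sub, abs_mul, abs_mul, mul_div_mul_left _ _ (abs_pos.2 hc.ne').ne'] at hlim
  refine hlim.congr fun n => ?_
  have hmem : ∀ x ∈ Icc (-1 : ℝ) 0, gw f (b :: true :: List.replicate n false) x ∈ side b :=
    fun x hx => hf.branch_mem b (hf.gw_mem (true :: List.replicate n false) (side_subset false hx))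
  rw [Pi.div_apply, ← mul_sub, ← mul_sub, abs_mul, abs_mul, mul_div_mul_left _ _
    (abs_pos.2 (Real.rpow_pos_of_pos (pow_pos hf.deriv_neg_one_pos n) _).ne').ne', lenRatio,
    abs_sub_abs_of_mem_side (hmem p hp) (hmem q hq),
    abs_sub_abs_of_mem_side (hmem r hr) (hmem s hs)]

end IsControlled

lemma eventually_agree (a : ℕ → Bool) (m : ℕ) : ∀ᶠ b in 𝓝 a, ∀ i < m, b i = a i := by
  have h : Set.pi (Iio m) (fun i => ({a i} : Set Bool)) ∈ 𝓝 a :=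
    set_pi_mem_nhds (finite_Iio m) fun i _ => (isOpen_discrete _).mem_nhds rfl
  filter_upwards [h] with b hb i hi
  exact hb i hi

/-- A dual point close to, but different from, a point which is eventually zero first
disagrees with it at a coordinate equal to `1`. -/
lemma exists_first_disagreement {a b : ℕ → Bool} {N m : ℕ} (ha : ∀ n > N, a n = false)
    (hab : ∀ i < m + N + 2, b i = a i) (hne : b ≠ a) :
    ∃ n ≥ m, b (N + n + 1) = true ∧ b 0 = a 0 ∧ innerWord b (N + n + 2) =
      b (N + n + 2) :: true :: List.replicate n false ++ innerWord a N := by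
  classical
  have hex : ∃ i, b i ≠ a i := Function.ne_iff.1 hne
  set i := Nat.find hex with hi
  have hi1 : b i ≠ a i := Nat.find_spec hex
  have hi2 : ∀ j < i, b j = a j := fun j hj => not_not.1 (Nat.find_min hex hj)
  have hi3 : m + N + 2 ≤ i := not_lt.1 fun h => hi1 (hab i h)
  obtain ⟨n, hn⟩ : ∃ n, i = N + n + 1 := ⟨i - N - 1, by omega⟩
  rw [hn] at hi1 hi2 hi3
  have hb : b (N + n + 1) = true := by
    rw [ha _ (by omega)] at hi1
    exact Bool.eq_true_of_not_eq_false hi1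
  refine ⟨n, by omega, hb, hab 0 (by omega), ?_⟩
  rw [innerWord, innerWord, hb, innerWord_congr (b := a) fun j hj => hi2 j (by omega),
    innerWord_add_of_false ha]
  rfl

namespace DistortionConstants

lemma tendsto_exp_mul_θ_pow (k : DistortionConstants) (c : ℝ) (N : ℕ) :
    Tendsto (fun n => Real.exp (c * k.θ ^ (N + n))) atTop (𝓝 1) := by
  have h := (tendsto_pow_atTop_nhds_zero_of_lt_one k.θ_pos.le k.θ_lt_one).comp
    (tendsto_add_atTop_nat N)
  have h2 := (Real.continuous_exp.tendsto _).comp (h.const_mul c)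
  rw [mul_zero, Real.exp_zero] at h2
  refine h2.congr fun n => ?_
  rw [Function.comp_apply, Function.comp_apply, add_comm]

end DistortionConstants

namespace IsControlled

variable {k : DistortionConstants} {f f' : ℝ → ℝ}

lemma abs_rpow_linearization_ratio_ne (hf : IsControlled k 0 f f') {φ : ℝ → ℝ}
    (hmono : StrictMonoOn φ (Icc (-1) 0)) (hφ0 : φ (-1) = 0) (b : Bool) {w : List Bool}
    (hw : ∀ x ∈ Icc (-1 : ℝ) 1, gw f w x ∈ Icc (-1 : ℝ) 0) :
    |φ (gw f w (branch f b 1)) ^ k.γ⁻¹ - φ (gw f w (branch f b (-1))) ^ k.γ⁻¹| /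
        |φ (gw f w 1) ^ k.γ⁻¹ - φ (gw f w (-1)) ^ k.γ⁻¹| ≠
      |φ (gw f w (branch f b 1)) - φ (gw f w (branch f b (-1)))| /
        |φ (gw f w 1) - φ (gw f w (-1))| := by
  have hz : (0 : ℝ) ∈ Icc (-1 : ℝ) 1 := by norm_num
  have hnn : ∀ x ∈ Icc (-1 : ℝ) 1, 0 ≤ φ (gw f w x) := fun x hx =>
    hφ0 ▸ hmono.monotoneOn (left_mem_Icc.2 (by norm_num)) (hw x hx) (hw x hx).1
  have hinj : ∀ x ∈ Icc (-1 : ℝ) 1, ∀ y ∈ Icc (-1 : ℝ) 1, x ≠ y → φ (gw f w x) ≠ φ (gw f w y) :=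
    fun x hx y hy hxy h => hxy (hf.gw_injOn w hx hy (hmono.injOn (hw x hx) (hw y hy) h))
  rw [hf.branch_one]
  refine abs_rpow_sub_div_ne (inv_pos.2 k.γ_pos) (inv_lt_one_of_one_lt₀ k.one_lt_γ)
    (hnn 1 one_mem) (hnn (-1) neg_one_mem) ?_ (hinj _ hz _ one_mem (by norm_num))
    (hinj _ hz _ neg_one_mem (by norm_num)) ?_
  · have hmem : gw f w 0 ∈ uIcc (gw f w 1) (gw f w (-1)) := by
      rw [← hf.image_gw_uIcc w one_mem neg_one_mem]
      exact mem_image_of_mem _ (by rw [uIcc_of_ge (by norm_num)]; exact hz)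
    rcases mem_uIcc.1 hmem with h | h
    · exact mem_uIcc.2 (Or.inl ⟨hmono.monotoneOn (hw 1 one_mem) (hw 0 hz) h.1,
        hmono.monotoneOn (hw 0 hz) (hw _ neg_one_mem) h.2⟩)
    · exact mem_uIcc.2 (Or.inr ⟨hmono.monotoneOn (hw _ neg_one_mem) (hw 0 hz) h.1,
        hmono.monotoneOn (hw 0 hz) (hw 1 one_mem) h.2⟩)
  · cases b
    · rw [hf.branch_false_neg_one]
      exact Or.inr rfl
    · rw [hf.branch_true_neg_one]
      exact Or.inl rfl

end IsControlled

/-- Theorem A, part 2.1: the limiting scaling function `s₀` (the pointwise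
limit as `ε ↓ 0` of the scaling functions `s_ε` of a good family) has a jump discontinuity at
every point `a*` of `𝒜` (the dual points that are eventually all zeroes): the limit of
`s₀(b*)` as `b* → a*`, `b* ≠ a*`, exists but differs from `s₀(a*)`. -/
theorem limit_scaling_function_jump_discontinuities (F : GoodFamily)
    (s : ℝ → (ℕ → Bool) → ℝ)
    (hs : ∀ ε ∈ Ioc 0 F.eps0, IsScalingFun (F.f ε) (s ε))
    (s0 : (ℕ → Bool) → ℝ)
    (hs0 : ∀ a : ℕ → Bool,
      Tendsto (fun ε => s ε a) (nhdsWithin 0 (Ioc 0 F.eps0)) (nhds (s0 a))) :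
    ∀ a : ℕ → Bool, EvZero a →
      ∃ L : ℝ, Tendsto s0 (nhdsWithin a {a}ᶜ) (nhds L) ∧ L ≠ s0 a := by
  intro a ⟨N₀, hN₀⟩
  obtain ⟨k, hγ, hk⟩ := F.exists_isControlled
  have hf := hk 0 F.zero_mem
  choose ρ hρ0 hρ using F.exists_tendsto_residue
  simp only [← hγ] at hρ
  obtain ⟨φ, hmono, hφ0, hφ⟩ := hf.exists_linearization
  set f := F.f 0 with hfdef
  set N := N₀ + 1 with hN
  have ha : ∀ n > N, a n = false := fun n hn => hN₀ n (by omega)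
  have hw : ∀ x ∈ Icc (-1 : ℝ) 1, gw f (innerWord a N) x ∈ Icc (-1 : ℝ) 0 := fun x hx => by
    rw [hN, innerWord, hN₀ _ (by omega), gw_cons]
    exact hf.branch_mem false (hf.gw_mem _ hx)
  have hp := hw _ (hf.branch_mem_Icc (a 0) one_mem)
  have hq := hw _ (hf.branch_mem_Icc (a 0) neg_one_mem)
  have hr := hw _ one_mem
  have hs' := hw _ neg_one_mem
  have hrs : gw f (innerWord a N) 1 ≠ gw f (innerWord a N) (-1) := fun h => by
    have := hf.gw_injOn _ one_mem neg_one_mem h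
    norm_num at this
  have hscale : s0 a = |φ (gw f (innerWord a N) (branch f (a 0) 1)) -
        φ (gw f (innerWord a N) (branch f (a 0) (-1)))| /
      |φ (gw f (innerWord a N) 1) - φ (gw f (innerWord a N) (-1))| := by
    have h1 := (hf.tendsto_lenRatio_replicate hmono hφ hp hq hr hs' hrs).comp
      (tendsto_add_atTop_nat 1)
    have h2 : ∀ n, lenRatio f (List.replicate (n + 1) false)
        (gw f (innerWord a N) (branch f (a 0) 1)) (gw f (innerWord a N) (branch f (a 0) (-1)))
        (gw f (innerWord a N) 1) (gw f (innerWord a N) (-1)) = ratio f a (N + n + 1) := fun n => by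
      rw [hf.ratio_eq, add_assoc, innerWord_add_of_false ha, lenRatio_append]
    have h3 := h1.congr h2
    have h4 := k.tendsto_exp_mul_θ_pow (k.stepConst / (1 - k.θ)) N
    have h5 := fun n => F.limit_scaling_le_of_false hk hs (hs0 a) (m := N + n)
      fun i hi => ha i (by omega)
    refine le_antisymm ?_ ?_
    · have h6 := h4.mul h3
      rw [one_mul] at h6
      exact ge_of_tendsto' h6 fun n => (h5 n).1
    · have h6 := h4.mul_const (s0 a)
      rw [one_mul] at h6
      exact le_of_tendsto_of_tendsto' h3 h6 fun n => (h5 n).2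
  refine ⟨_, ?_, fun h => hf.abs_rpow_linearization_ratio_ne hmono hφ0 (a 0) hw (h.trans hscale)⟩
  have hfold := fun b => hf.tendsto_lenRatio_fold b (hρ0 b) (hρ b) hmono hφ0 hφ hp hq hr hs' hrs
  have hE := k.tendsto_exp_mul_θ_pow k.distConst (N + 1)
  have hlow := fun b => (hfold b).div hE one_ne_zero
  have hup := fun b => hE.mul (hfold b)
  simp only [div_one, one_mul] at hlow hup
  have key : ∀ m, ∀ᶠ b in 𝓝[{a}ᶜ] a, ∃ n ≥ m, ∃ c,
      lenRatio f (c :: true :: List.replicate n false)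
        (gw f (innerWord a N) (branch f (a 0) 1)) (gw f (innerWord a N) (branch f (a 0) (-1)))
        (gw f (innerWord a N) 1) (gw f (innerWord a N) (-1)) /
          Real.exp (k.distConst * k.θ ^ (N + 1 + n)) ≤ s0 b ∧
      s0 b ≤ Real.exp (k.distConst * k.θ ^ (N + 1 + n)) *
        lenRatio f (c :: true :: List.replicate n false)
        (gw f (innerWord a N) (branch f (a 0) 1)) (gw f (innerWord a N) (branch f (a 0) (-1)))
        (gw f (innerWord a N) 1) (gw f (innerWord a N) (-1)) := by
    intro m
    filter_upwards [self_mem_nhdsWithin,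
      nhdsWithin_le_nhds (eventually_agree a (m + N + 2))] with b hb hab
    obtain ⟨n, hn, hbn, hb0, hword⟩ := exists_first_disagreement ha hab hb
    refine ⟨n, hn, b (N + n + 2), ?_⟩
    have h1 := F.limit_scaling_le_of_true hk hs (hs0 b) (by omega) hbn
    rw [hf.ratio_eq, hword, hb0, lenRatio_append, add_right_comm N n 1] at h1
    exact ⟨(div_le_iff₀' (Real.exp_pos _)).2 h1.2, h1.1⟩
  refine tendsto_order.2 ⟨fun l hl => ?_, fun u hu => ?_⟩
  · obtain ⟨m, hm⟩ := eventually_atTop.1 (eventually_all.2 fun b => (hlow b).eventually_const_lt hl)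
    filter_upwards [key m] with b ⟨n, hn, c, h1, _⟩
    exact (hm n hn c).trans_le h1
  · obtain ⟨m, hm⟩ := eventually_atTop.1 (eventually_all.2 fun b => (hup b).eventually_lt_const hu)
    filter_upwards [key m] with b ⟨n, hn, c, _, h2⟩
    exact h2.trans_lt (hm n hn c)
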